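/- arXiv:2308.12268 — 3 statements merged into one kernel-verified Lean document; each statement's English description precedes it below -/
import Mathlib

section
/- Fix an integer r ≥ 1 and let A be the partition of {1,…,r} consisting of the single part {1,…,r} (so that x ≼_A y if and only if max_i x_i ≤ min_i y_i). Let S_n be a set of n independent, uniformly random points in [0,1]^r. Then L_A(S_n)/n^{1/r} converges in probability to r/Γ(1/r) as n → ∞, where Γ denotes the Gamma function. -/
open MeasureTheory

/-- The uniform probability measure on the cube `[0,1]^r`. -/
noncomputable def unifCube (r : ℕ) : Measure (Fin r → ℝ) :=
  Measure.pi fun _ => volume.restrict (Set.Icc (0 : ℝ) 1)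

/-- The law of `n` independent uniformly random points in `[0,1]^r`. -/
noncomputable def pointsMeasure (r n : ℕ) : Measure (Fin n → Fin r → ℝ) :=
  Measure.pi fun _ : Fin n => unifCube r

/-- The partial order `≼_A` on `ℝ^r` when `A` is the partition of `{1,…,r}`
with the single part `{1,…,r}`: `x ≼ y` iff `max_i x_i ≤ min_j y_j`. -/
def leSingleBlock {r : ℕ} (x y : Fin r → ℝ) : Prop :=
  ∀ i j : Fin r, x i ≤ y j

/-- `L_A(S)` for `S` the set of points `ω 0, …, ω (n-1)`, for the single-part
partition `A`: the maximum size of a chain contained in `S`. -/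
noncomputable def chainLenSingle {r n : ℕ} (ω : Fin n → Fin r → ℝ) : ℕ :=
  sSup {k | ∃ T : Finset (Fin r → ℝ), ↑T ⊆ Set.range ω ∧
    IsChain (fun x y : Fin r → ℝ => leSingleBlock x y) ↑T ∧ T.card = k}

/-- The largest coordinate of a point. -/
noncomputable def maxCoord {r : ℕ} (x : Fin r → ℝ) : ℝ := ⨆ i, x i

/-- The points all of whose coordinates are at least `a`. -/
def above (r : ℕ) (a : ℝ) : Set (Fin r → ℝ) := {x | ∀ l, a ≤ x l}

/-- The points all of whose coordinates lie in `[a, b)`. -/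
def gap (r : ℕ) (a b : ℝ) : Set (Fin r → ℝ) := {x | x ∈ above r a ∧ maxCoord x < b}

/-- Some point `p.2 i` lies above the level `p.1`, has the least `maxCoord` among the points
above that level, and the new level `maxCoord (p.2 i)` with the remaining points lies in `B`. -/
def greedyStep {r n : ℕ} (B : Set (ℝ × (Fin n → Fin r → ℝ))) :
    Set (ℝ × (Fin (n + 1) → Fin r → ℝ)) :=
  {p | ∃ i : Fin (n + 1), p.2 i ∈ above r p.1 ∧
    (∀ j, i.removeNth p.2 j ∉ gap r p.1 (maxCoord (p.2 i))) ∧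
    (maxCoord (p.2 i), i.removeNth p.2) ∈ B}

/-- The greedy construction of a chain above the level `p.1` can be run for `k` steps. -/
def greedyReach (r : ℕ) : (k n : ℕ) → Set (ℝ × (Fin n → Fin r → ℝ))
  | 0, _ => Set.univ
  | _ + 1, 0 => ∅
  | k + 1, n + 1 => greedyStep (greedyReach r k n)

/-- The greedy construction of a chain above the level `p.1` can stop before `k` steps. -/
def greedyStop (r : ℕ) : (k n : ℕ) → Set (ℝ × (Fin n → Fin r → ℝ))
  | 0, _ => ∅
  | _ + 1, 0 => Set.univ
  | k + 1, n + 1 => {p | ∀ j, p.2 j ∉ above r p.1} ∪ greedyStep (greedyStop r k n)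

/-- There are `k` indices whose points lie above the level `a` and form a chain. -/
def HasIndexChain {r n : ℕ} (k : ℕ) (a : ℝ) (ω : Fin n → Fin r → ℝ) : Prop :=
  ∃ T : Finset (Fin n), T.card = k ∧ (∀ i ∈ T, ω i ∈ above r a) ∧
    ∀ i ∈ T, ∀ j ∈ T, i ≠ j → leSingleBlock (ω i) (ω j) ∨ leSingleBlock (ω j) (ω i)

section Order

variable {r : ℕ}

theorem le_maxCoord (x : Fin r → ℝ) (l : Fin r) : x l ≤ maxCoord x :=
  le_ciSup (Finite.bddAbove_range x) l

theorem maxCoord_le_iff [NeZero r] {x : Fin r → ℝ} {b : ℝ} : maxCoord x ≤ b ↔ ∀ l, x l ≤ b :=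
  ciSup_le_iff (Finite.bddAbove_range x)

theorem exists_eq_maxCoord [NeZero r] (x : Fin r → ℝ) : ∃ l, x l = maxCoord x :=
  exists_eq_ciSup_of_finite

theorem maxCoord_lt_iff [NeZero r] {x : Fin r → ℝ} {b : ℝ} : maxCoord x < b ↔ ∀ l, x l < b := by
  refine ⟨fun h l => (le_maxCoord x l).trans_lt h, fun h => ?_⟩
  obtain ⟨l, hl⟩ := exists_eq_maxCoord x
  exact hl ▸ h l

theorem le_maxCoord_of_mem_above [NeZero r] {x : Fin r → ℝ} {a : ℝ} (h : x ∈ above r a) :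
    a ≤ maxCoord x :=
  (h 0).trans (le_maxCoord x 0)

theorem leSingleBlock_iff_mem_above [NeZero r] {x y : Fin r → ℝ} :
    leSingleBlock x y ↔ y ∈ above r (maxCoord x) :=
  ⟨fun h l => maxCoord_le_iff.2 fun i => h i l, fun h i j => (le_maxCoord x i).trans (h j)⟩

theorem exists_minimal_of_chain [NeZero r] {n : ℕ} {ω : Fin n → Fin r → ℝ} {T : Finset (Fin n)}
    (hT : T.Nonempty)
    (h : ∀ i ∈ T, ∀ j ∈ T, i ≠ j → leSingleBlock (ω i) (ω j) ∨ leSingleBlock (ω j) (ω i)) :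
    ∃ y ∈ T, ∀ z ∈ T, z ≠ y → leSingleBlock (ω y) (ω z) := by
  obtain ⟨y, hy, hmin⟩ := T.exists_min_image (fun i => ∑ l, ω i l) hT
  refine ⟨y, hy, fun z hz hzy => (h y hy z hz hzy.symm).elim id fun hle => ?_⟩
  have heq := (Finset.sum_eq_sum_iff_of_le fun l _ => hle l l).1
    ((Finset.sum_le_sum fun l _ => hle l l).antisymm (hmin z hz))
  intro i j
  rw [← heq i (Finset.mem_univ i), heq j (Finset.mem_univ j)]
  exact hle i j

theorem hasIndexChain_mem_greedyReach [NeZero r] {k n : ℕ} {a : ℝ} {ω : Fin n → Fin r → ℝ}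
    (h : HasIndexChain k a ω) : (a, ω) ∈ greedyReach r k n := by
  induction k generalizing n a with
  | zero => simp [greedyReach]
  | succ k ih =>
    obtain ⟨T, hcard, hab, hch⟩ := h
    have hT : T.Nonempty := by
      rw [← Finset.card_pos]; omega
    obtain ⟨y, hy, hmin⟩ := exists_minimal_of_chain hT hch
    cases n with
    | zero => exact y.elim0
    | succ n =>
      obtain ⟨i₀, hi₀, hi₀min⟩ := (Set.toFinite {i | ω i ∈ above r a}).exists_minimalFor
        (fun i => maxCoord (ω i)) _ ⟨y, hab y hy⟩
      have hle : ∀ j, ω j ∈ above r a → maxCoord (ω i₀) ≤ maxCoord (ω j) := fun j hj =>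
        (le_total _ _).elim id (hi₀min hj)
      obtain ⟨i, hi, hieq, hiT⟩ : ∃ i, ω i ∈ above r a ∧ maxCoord (ω i) = maxCoord (ω i₀) ∧
          i ∉ T.erase y := by
        by_cases heq : maxCoord (ω y) = maxCoord (ω i₀)
        · exact ⟨y, hab y hy, heq, by simp⟩
        · refine ⟨i₀, hi₀, rfl, fun hmem => heq ?_⟩
          obtain ⟨hne, hmem⟩ := Finset.mem_erase.1 hmem
          exact le_antisymm
            (le_maxCoord_of_mem_above (leSingleBlock_iff_mem_above.1 (hmin i₀ hmem hne)))
            (hle y (hab y hy))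
      obtain ⟨T', hT'⟩ : ∃ T' : Finset (Fin n), T'.map i.succAboveEmb = T.erase y := by
        have : (T.erase y : Set (Fin (n + 1))) ⊆ i.succAbove '' Set.univ := by
          rw [Set.image_univ, Fin.range_succAbove]
          intro z hz hzi
          exact hiT (hzi ▸ hz)
        obtain ⟨T', -, hT'⟩ := Finset.subset_set_image_iff.1 this
        exact ⟨T', by rw [← hT', Finset.map_eq_image]; rfl⟩
      have hmem : ∀ {j}, j ∈ T' → i.succAbove j ∈ T ∧ i.succAbove j ≠ y := fun {j} hj => by
        have : i.succAbove j ∈ T.erase y := hT' ▸ Finset.mem_map_of_mem i.succAboveEmb hj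
        exact ⟨Finset.mem_of_mem_erase this, Finset.ne_of_mem_erase this⟩
      refine ⟨i, hi, fun j hj => ?_, ih ⟨T', ?_, fun j hj l => ?_, fun j hj j' hj' hne => ?_⟩⟩
      · exact absurd hj.2 (not_lt.2 (hieq ▸ hle _ hj.1))
      · rw [← T'.card_map i.succAboveEmb, hT', Finset.card_erase_of_mem hy, hcard]
        rfl
      · exact (hieq.trans_le (hle y (hab y hy))).trans
          (leSingleBlock_iff_mem_above.1 (hmin _ (hmem hj).1 (hmem hj).2) l)
      · exact hch _ (hmem hj).1 _ (hmem hj').1 fun h => hne (Fin.succAbove_right_injective h)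

theorem mem_greedyStop_of_not_hasIndexChain [NeZero r] {k n : ℕ} {a : ℝ}
    {ω : Fin n → Fin r → ℝ} (h : ¬ HasIndexChain k a ω) : (a, ω) ∈ greedyStop r k n := by
  induction k generalizing n a with
  | zero => exact (h ⟨∅, by simp⟩).elim
  | succ k ih =>
    cases n with
    | zero => trivial
    | succ n =>
      by_cases hne : ∀ j, ω j ∉ above r a
      · exact Or.inl hne
      push Not at hne
      obtain ⟨i, hi, himin⟩ := (Set.toFinite {i | ω i ∈ above r a}).exists_minimalFor
        (fun i => maxCoord (ω i)) _ hne
      refine Or.inr ⟨i, hi, fun j hj => hj.2.not_ge (himin hj.1 hj.2.le), ih fun hT => h ?_⟩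
      obtain ⟨T, hcard, hab, hch⟩ := hT
      have hle : ∀ j ∈ T, leSingleBlock (ω i) (ω (i.succAbove j)) := fun j hj =>
        leSingleBlock_iff_mem_above.2 (hab j hj)
      refine ⟨insert i (T.map i.succAboveEmb), ?_, ?_, ?_⟩
      · rw [Finset.card_insert_of_notMem (by simp [Fin.succAbove_ne]), Finset.card_map, hcard]
      · simp only [Finset.mem_insert, Finset.mem_map, Fin.coe_succAboveEmb]
        rintro _ (rfl | ⟨j, hj, rfl⟩)
        · exact hi
        · exact fun l => (le_maxCoord_of_mem_above hi).trans (hab j hj l)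
      · simp only [Finset.mem_insert, Finset.mem_map, Fin.coe_succAboveEmb]
        rintro _ (rfl | ⟨j, hj, rfl⟩) _ (rfl | ⟨j', hj', rfl⟩) hjj
        · exact (hjj rfl).elim
        · exact Or.inl (hle j' hj')
        · exact Or.inr (hle j hj)
        · exact hch j hj j' hj' fun h => hjj (h ▸ rfl)

theorem chain_card_le {n : ℕ} (ω : Fin n → Fin r → ℝ) :
    ∀ k ∈ {k | ∃ T : Finset (Fin r → ℝ), ↑T ⊆ Set.range ω ∧
      IsChain (fun x y : Fin r → ℝ => leSingleBlock x y) ↑T ∧ T.card = k}, k ≤ n := by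
  classical
  rintro k ⟨T, hT, -, rfl⟩
  have : T ⊆ Finset.univ.image ω := fun x hx => by
    obtain ⟨i, rfl⟩ := hT hx
    simp
  exact (Finset.card_le_card this).trans (Finset.card_image_le.trans (by simp))

theorem chainLenSingle_le {n : ℕ} (ω : Fin n → Fin r → ℝ) : chainLenSingle ω ≤ n :=
  csSup_le ⟨0, ∅, by simp⟩ (chain_card_le ω)

theorem hasIndexChain_of_le_chainLenSingle {k n : ℕ} {a : ℝ} {ω : Fin n → Fin r → ℝ}
    (ha : ∀ i, ω i ∈ above r a) (h : k ≤ chainLenSingle ω) : HasIndexChain k a ω := by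
  classical
  obtain ⟨T, hT, hch, hcard⟩ := Nat.sSup_mem
    (s := {k | ∃ T : Finset (Fin r → ℝ), (T : Set (Fin r → ℝ)) ⊆ Set.range ω ∧
      IsChain (fun x y : Fin r → ℝ => leSingleBlock x y) ↑T ∧ T.card = k})
    ⟨0, ∅, by simp⟩ ⟨n, chain_card_le ω⟩
  obtain ⟨U, hUT, hU⟩ := Finset.exists_subset_card_eq (h.trans_eq hcard.symm)
  obtain rfl | ⟨x₀, hx₀⟩ := U.eq_empty_or_nonempty
  · exact ⟨∅, by simpa using hU⟩
  have : Nonempty (Fin n) := ⟨(hT (hUT hx₀)).choose⟩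
  choose! f hf using fun x (hx : x ∈ U) => hT (hUT hx)
  have hinj : Set.InjOn f U := fun x hx y hy hxy => by
    rw [← hf x hx, ← hf y hy, hxy]
  refine ⟨U.image f, by rw [Finset.card_image_of_injOn hinj, hU], fun i _ => ha i, ?_⟩
  simp only [Finset.mem_image]
  rintro _ ⟨x, hx, rfl⟩ _ ⟨y, hy, rfl⟩ hxy
  rw [hf x hx, hf y hy]
  exact hch (hUT hx) (hUT hy) fun h => hxy (h ▸ rfl)

theorem le_chainLenSingle_of_hasIndexChain {k n : ℕ} {a : ℝ} {ω : Fin n → Fin r → ℝ}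
    (hω : Function.Injective ω) (h : HasIndexChain k a ω) : k ≤ chainLenSingle ω := by
  obtain ⟨T, hcard, -, hch⟩ := h
  refine le_csSup ⟨n, chain_card_le ω⟩ ⟨T.map ⟨ω, hω⟩, ?_, ?_, by rw [Finset.card_map, hcard]⟩
  · simp
  · simp only [Finset.coe_map, Function.Embedding.coeFn_mk]
    rintro _ ⟨i, hi, rfl⟩ _ ⟨j, hj, rfl⟩ hij
    exact hch i hi j hj fun h => hij (h ▸ rfl)

end Order

section GreedyMeasure

variable {r : ℕ}

theorem unifCube_eq_restrict (r : ℕ) :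
    unifCube r = volume.restrict (Set.univ.pi fun _ => Set.Icc (0 : ℝ) 1) := by
  rw [volume_pi, Measure.restrict_pi_pi]
  rfl

instance : IsProbabilityMeasure (unifCube r) := by
  have : IsProbabilityMeasure (volume.restrict (Set.Icc (0 : ℝ) 1)) := ⟨by simp⟩
  unfold unifCube
  infer_instance

instance (n : ℕ) : IsProbabilityMeasure (pointsMeasure r n) := by
  unfold pointsMeasure
  infer_instance

theorem ae_unifCube_mem_Icc (r : ℕ) : ∀ᵐ x ∂unifCube r, ∀ l, x l ∈ Set.Icc (0 : ℝ) 1 := by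
  rw [unifCube_eq_restrict]
  filter_upwards [ae_restrict_mem (MeasurableSet.univ_pi fun _ => measurableSet_Icc)] with x hx l
    using hx l trivial

theorem measurable_maxCoord : Measurable (maxCoord : (Fin r → ℝ) → ℝ) :=
  Measurable.iSup fun l => measurable_pi_apply l

theorem measurableSet_mem_above {α : Type*} [MeasurableSpace α] {f : α → Fin r → ℝ} {g : α → ℝ}
    (hf : Measurable f) (hg : Measurable g) : MeasurableSet {p | f p ∈ above r (g p)} := by
  change MeasurableSet {p | ∀ l, g p ≤ f p l}
  rw [Set.ofPred_forall]
  exact MeasurableSet.iInter fun l => measurableSet_le hg (measurable_pi_iff.1 hf l)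

theorem measurableSet_mem_gap {α : Type*} [MeasurableSpace α] {f : α → Fin r → ℝ} {g h : α → ℝ}
    (hf : Measurable f) (hg : Measurable g) (hh : Measurable h) :
    MeasurableSet {p | f p ∈ gap r (g p) (h p)} :=
  (measurableSet_mem_above hf hg).inter (measurableSet_lt (measurable_maxCoord.comp hf) hh)

theorem measurableSet_above (a : ℝ) : MeasurableSet (above r a) :=
  measurableSet_mem_above measurable_id measurable_const

theorem measurableSet_gap (a b : ℝ) : MeasurableSet (gap r a b) :=
  measurableSet_mem_gap measurable_id measurable_const measurable_const

theorem measurable_removeNth {n : ℕ} (i : Fin (n + 1)) :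
    Measurable fun ω : Fin (n + 1) → Fin r → ℝ => i.removeNth ω :=
  measurable_pi_lambda _ fun j => measurable_pi_apply (i.succAbove j)

theorem measurableSet_greedyStep {n : ℕ} {B : Set (ℝ × (Fin n → Fin r → ℝ))}
    (hB : MeasurableSet B) : MeasurableSet (greedyStep B) := by
  have hpt (i : Fin (n + 1)) : Measurable fun p : ℝ × (Fin (n + 1) → Fin r → ℝ) => p.2 i :=
    (measurable_pi_apply i).comp measurable_snd
  have hrem (i : Fin (n + 1)) :
      Measurable fun p : ℝ × (Fin (n + 1) → Fin r → ℝ) => i.removeNth p.2 :=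
    (measurable_removeNth i).comp measurable_snd
  simp only [greedyStep, Set.ofPred_exists, Set.ofPred_and, Set.ofPred_forall]
  refine MeasurableSet.iUnion fun i => (measurableSet_mem_above (hpt i) measurable_fst).inter
    ((MeasurableSet.iInter fun j => ?_).inter ?_)
  · exact (measurableSet_mem_gap (measurable_pi_iff.1 (hrem i) j) measurable_fst
      (measurable_maxCoord.comp (hpt i))).compl
  · exact ((measurable_maxCoord.comp (hpt i)).prodMk (hrem i)) hB

theorem measurableSet_greedyReach (k n : ℕ) : MeasurableSet (greedyReach r k n) := by
  induction k generalizing n with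
  | zero => exact MeasurableSet.univ
  | succ k ih =>
    cases n with
    | zero => exact MeasurableSet.empty
    | succ n => exact measurableSet_greedyStep (ih n)

theorem measurableSet_greedyStop (k n : ℕ) : MeasurableSet (greedyStop r k n) := by
  induction k generalizing n with
  | zero => exact MeasurableSet.empty
  | succ k ih =>
    cases n with
    | zero => exact MeasurableSet.univ
    | succ n =>
      refine MeasurableSet.union ?_ (measurableSet_greedyStep (ih n))
      simp only [Set.ofPred_forall]
      exact MeasurableSet.iInter fun j => (measurableSet_mem_above
        ((measurable_pi_apply j).comp measurable_snd) measurable_fst).compl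

theorem gap_eq_pi [NeZero r] (a b : ℝ) : gap r a b = Set.univ.pi fun _ => Set.Ico a b := by
  ext x
  simp only [gap, above, Set.mem_ofPred_eq, maxCoord_lt_iff, Set.mem_univ_pi, Set.mem_Ico,
    forall_and]

theorem unifCube_gap [NeZero r] {a b : ℝ} (ha : 0 ≤ a) (hab : a ≤ b) (hb : b ≤ 1) :
    (unifCube r).real (gap r a b) = (b - a) ^ r := by
  have hsub : gap r a b ⊆ Set.univ.pi fun _ => Set.Icc (0 : ℝ) 1 := by
    rw [gap_eq_pi]
    exact Set.pi_mono fun _ _ => Set.Ico_subset_Icc_self.trans (Set.Icc_subset_Icc ha hb)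
  rw [measureReal_def, unifCube_eq_restrict, Measure.restrict_eq_self _ hsub, gap_eq_pi,
    Real.volume_pi_Ico]
  simp [ENNReal.toReal_ofReal (sub_nonneg.2 hab)]

theorem pi_restrict_greedyStep_le {n : ℕ} {B : Set (ℝ × (Fin n → Fin r → ℝ))}
    (hB : MeasurableSet B) {S : Set (Fin r → ℝ)} (a : ℝ) :
    Measure.pi (fun _ : Fin (n + 1) => (unifCube r).restrict S) {ω | (a, ω) ∈ greedyStep B} ≤
      (n + 1 : ℕ) * ∫⁻ x in above r a,
        Measure.pi (fun _ : Fin n => (unifCube r).restrict (S \ gap r a (maxCoord x)))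
          {y | (maxCoord x, y) ∈ B} ∂unifCube r := by
  set ν := (unifCube r).restrict S
  set D : Set ((Fin r → ℝ) × (Fin n → Fin r → ℝ)) :=
    {p | p.1 ∈ above r a ∧ (∀ j, p.2 j ∉ gap r a (maxCoord p.1)) ∧ (maxCoord p.1, p.2) ∈ B}
  have hD : MeasurableSet D := by
    refine (measurableSet_mem_above measurable_fst measurable_const).inter
      (MeasurableSet.inter ?_ ?_)
    · change MeasurableSet {p : (Fin r → ℝ) × (Fin n → Fin r → ℝ) |
        ∀ j, p.2 j ∉ gap r a (maxCoord p.1)}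
      rw [Set.ofPred_forall]
      exact MeasurableSet.iInter fun j => (measurableSet_mem_gap
        ((measurable_pi_apply j).comp measurable_snd) measurable_const
        (measurable_maxCoord.comp measurable_fst)).compl
    · exact ((measurable_maxCoord.comp measurable_fst).prodMk measurable_snd) hB
  have hcover : {ω | (a, ω) ∈ greedyStep B} =
      ⋃ i : Fin (n + 1), MeasurableEquiv.piFinSuccAbove (fun _ => Fin r → ℝ) i ⁻¹' D := by
    ext ω
    simp only [Set.mem_iUnion]
    rfl
  have hsec (x : Fin r → ℝ) : Measure.pi (fun _ : Fin n => ν) (Prod.mk x ⁻¹' D) ≤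
      (above r a).indicator (fun x =>
        Measure.pi (fun _ : Fin n => (unifCube r).restrict (S \ gap r a (maxCoord x)))
          {y | (maxCoord x, y) ∈ B}) x := by
    by_cases hx : x ∈ above r a
    · rw [Set.indicator_of_mem hx]
      have heq : Prod.mk x ⁻¹' D = {y | (maxCoord x, y) ∈ B} ∩
          Set.univ.pi fun _ => (gap r a (maxCoord x))ᶜ := by
        ext y
        simp [D, hx, and_comm]
      have hgap := (measurableSet_gap (r := r) a (maxCoord x)).compl
      rw [heq, ← Measure.restrict_apply' (MeasurableSet.univ_pi fun _ => hgap),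
        Measure.restrict_pi_pi, Measure.restrict_restrict hgap, Set.inter_comm, Set.sdiff_eq]
    · have : Prod.mk x ⁻¹' D = ∅ := Set.eq_empty_of_forall_notMem fun y hy => hx hy.1
      simp [this]
  calc _ ≤ ∑ i : Fin (n + 1), Measure.pi (fun _ : Fin (n + 1) => ν)
        (MeasurableEquiv.piFinSuccAbove (fun _ => Fin r → ℝ) i ⁻¹' D) := by
        rw [hcover]; exact measure_iUnion_fintype_le _ _
    _ = (n + 1 : ℕ) * (ν.prod (Measure.pi fun _ : Fin n => ν)) D := by
        simp_rw [(measurePreserving_piFinSuccAbove (fun _ : Fin (n + 1) => ν) _).measure_preimage_equiv]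
        simp
    _ ≤ _ := by
        gcongr
        rw [Measure.prod_apply hD, ← lintegral_indicator (measurableSet_above a)]
        exact (lintegral_mono hsec).trans (lintegral_mono' Measure.restrict_le_self le_rfl)

theorem pi_restrict_greedyStep_le_of_bound [NeZero r] {n m : ℕ}
    {B : Set (ℝ × (Fin n → Fin r → ℝ))} (hB : MeasurableSet B) {S : Set (Fin r → ℝ)}
    {a κ D G : ℝ} (ha : 0 ≤ a) (hS : MeasurableSet S) (haS : above r a ⊆ S) (hD : 0 ≤ D)
    (hG : ∫⁻ x in above r a,
      ENNReal.ofReal (Real.exp (-κ * (maxCoord x - a) - m * (maxCoord x - a) ^ r)) ∂unifCube r ≤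
        ENNReal.ofReal G)
    (hbound : ∀ b S', 0 ≤ b → b ≤ 1 → MeasurableSet S' → above r b ⊆ S' →
      Measure.pi (fun _ : Fin n => (unifCube r).restrict S') {y | (b, y) ∈ B} ≤
        ENNReal.ofReal (D * ((unifCube r).real S' ^ m * Real.exp (κ * (1 - b))))) :
    Measure.pi (fun _ : Fin (n + 1) => (unifCube r).restrict S) {ω | (a, ω) ∈ greedyStep B} ≤
      ENNReal.ofReal ((n + 1 : ℕ) * G * D *
        ((unifCube r).real S ^ m * Real.exp (κ * (1 - a)))) := by
  set M := (unifCube r).real S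
  have hM0 : 0 ≤ M := measureReal_nonneg
  have hM1 : M ≤ 1 := measureReal_le_one
  set C := D * (M ^ m * Real.exp (κ * (1 - a)))
  have hC : 0 ≤ C := by positivity
  have hpt : ∀ᵐ x ∂(unifCube r).restrict (above r a),
      Measure.pi (fun _ : Fin n => (unifCube r).restrict (S \ gap r a (maxCoord x)))
        {y | (maxCoord x, y) ∈ B} ≤
      ENNReal.ofReal C *
        ENNReal.ofReal (Real.exp (-κ * (maxCoord x - a) - m * (maxCoord x - a) ^ r)) := by
    filter_upwards [ae_restrict_of_ae (ae_unifCube_mem_Icc r),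
      ae_restrict_mem (measurableSet_above a)] with x hx hxa
    set b := maxCoord x
    have hab : a ≤ b := le_maxCoord_of_mem_above hxa
    have hb : b ≤ 1 := maxCoord_le_iff.2 fun l => (hx l).2
    refine (hbound b _ (ha.trans hab) hb (hS.diff (measurableSet_gap a b)) ?_).trans ?_
    · exact fun y hy => ⟨haS fun l => hab.trans (hy l),
        fun hy' => (le_maxCoord_of_mem_above hy).not_gt hy'.2⟩
    · rw [← ENNReal.ofReal_mul hC]
      refine ENNReal.ofReal_le_ofReal ?_
      have hs : 0 ≤ (b - a) ^ r := pow_nonneg (sub_nonneg.2 hab) r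
      have hdiff : (unifCube r).real (S \ gap r a b) ≤ M * Real.exp (-(b - a) ^ r) := by
        rw [measureReal_sdiff (fun y hy => haS hy.1) (measurableSet_gap a b),
          unifCube_gap ha hab hb]
        nlinarith [Real.add_one_le_exp (-(b - a) ^ r)]
      calc _ ≤ D * ((M * Real.exp (-(b - a) ^ r)) ^ m * Real.exp (κ * (1 - b))) := by gcongr
        _ = _ := by
          rw [mul_pow, ← Real.exp_nat_mul]
          simp only [C, mul_assoc, ← Real.exp_add]
          ring_nf
  calc _ ≤ _ := pi_restrict_greedyStep_le hB a
    _ ≤ (n + 1 : ℕ) * (ENNReal.ofReal C * ENNReal.ofReal G) := by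
        gcongr
        refine (lintegral_mono_ae hpt).trans ?_
        rw [lintegral_const_mul' _ _ ENNReal.ofReal_ne_top]
        gcongr
    _ = _ := by
        rw [← ENNReal.ofReal_mul hC, ← ENNReal.ofReal_natCast, ← ENNReal.ofReal_mul (by positivity)]
        congr 1
        simp only [C]
        ring

end GreedyMeasure

section GreedyBounds

variable {r : ℕ}

theorem pi_restrict_greedyReach_le [NeZero r] {N m : ℕ} {κ G : ℝ} (hκ : 0 ≤ κ) (hG0 : 0 ≤ G)
    (hG : ∀ a, 0 ≤ a → ∫⁻ x in above r a,
      ENNReal.ofReal (Real.exp (-κ * (maxCoord x - a) - m * (maxCoord x - a) ^ r)) ∂unifCube r ≤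
        ENNReal.ofReal G)
    {k n : ℕ} (hn : n = m + k) (hN : n ≤ N) {a : ℝ} {S : Set (Fin r → ℝ)} (ha : 0 ≤ a)
    (ha1 : a ≤ 1) (hS : MeasurableSet S) (haS : above r a ⊆ S) :
    Measure.pi (fun _ : Fin n => (unifCube r).restrict S) {ω | (a, ω) ∈ greedyReach r k n} ≤
      ENNReal.ofReal ((N * G) ^ k * ((unifCube r).real S ^ m * Real.exp (κ * (1 - a)))) := by
  induction k generalizing n a S with
  | zero =>
    obtain rfl : n = m := hn
    have hexp : 1 ≤ Real.exp (κ * (1 - a)) :=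
      Real.one_le_exp (mul_nonneg hκ (sub_nonneg.2 ha1))
    calc _ ≤ Measure.pi (fun _ : Fin n => (unifCube r).restrict S) Set.univ :=
          measure_mono (Set.subset_univ _)
      _ = ENNReal.ofReal ((unifCube r).real S ^ n) := by
          simp [Measure.pi_univ, ENNReal.ofReal_pow, measureReal_def]
      _ ≤ _ := by
          refine ENNReal.ofReal_le_ofReal ?_
          rw [pow_zero, one_mul]
          exact le_mul_of_one_le_right (by positivity) hexp
  | succ k ih =>
    obtain ⟨n, rfl⟩ : ∃ n', n = n' + 1 := ⟨m + k, by omega⟩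
    refine (pi_restrict_greedyStep_le_of_bound (measurableSet_greedyReach k n) ha hS haS
      (D := (N * G) ^ k) (by positivity) (hG a ha) fun b S' hb hb1 hS' hbS' =>
        ih (by omega) (by omega) hb hb1 hS' hbS').trans (ENNReal.ofReal_le_ofReal ?_)
    rw [pow_succ' (N * G) k]
    have : ((n + 1 : ℕ) : ℝ) ≤ N := by exact_mod_cast hN
    gcongr

theorem pi_restrict_greedyStop_le [NeZero r] {N m : ℕ} {κ G q C : ℝ} (hC0 : 0 ≤ C)
    (hG0 : 0 ≤ G) (hq : 1 ≤ q) (hNq : N * G ≤ q)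
    (hC : ∀ u, 0 ≤ u → u ≤ 1 → Real.exp (-(m * u ^ r)) ≤ C * Real.exp (κ * u))
    (hG : ∀ a, 0 ≤ a → ∫⁻ x in above r a,
      ENNReal.ofReal (Real.exp (-κ * (maxCoord x - a) - m * (maxCoord x - a) ^ r)) ∂unifCube r ≤
        ENNReal.ofReal G)
    {k n : ℕ} (hn : m + k ≤ n) (hN : n ≤ N) {a : ℝ} {S : Set (Fin r → ℝ)} (ha : 0 ≤ a)
    (ha1 : a ≤ 1) (hS : MeasurableSet S) (haS : above r a ⊆ S) :
    Measure.pi (fun _ : Fin n => (unifCube r).restrict S) {ω | (a, ω) ∈ greedyStop r k n} ≤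
      ENNReal.ofReal (C * k * q ^ k * ((unifCube r).real S ^ m * Real.exp (κ * (1 - a)))) := by
  induction k generalizing n a S with
  | zero => simp [greedyStop]
  | succ k ih =>
    obtain ⟨n, rfl⟩ : ∃ n', n = n' + 1 := ⟨n - 1, by omega⟩
    have hstep := pi_restrict_greedyStep_le_of_bound (measurableSet_greedyStop k n) ha hS haS
      (D := C * k * q ^ k) (by positivity) (hG a ha) fun b S' hb hb1 hS' hbS' =>
        ih (by omega) (by omega) hb hb1 hS' hbS'
    set M := (unifCube r).real S
    have hM0 : 0 ≤ M := measureReal_nonneg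
    have hM1 : M ≤ 1 := measureReal_le_one
    have hnone : Measure.pi (fun _ : Fin (n + 1) => (unifCube r).restrict S)
        {ω | ∀ j, ω j ∉ above r a} ≤
          ENNReal.ofReal (C * (M ^ m * Real.exp (κ * (1 - a)))) := by
      have hs : 0 ≤ (1 - a) ^ r := pow_nonneg (sub_nonneg.2 ha1) r
      have hmiss : ((unifCube r).restrict S).real (above r a)ᶜ ≤ M * Real.exp (-(1 - a) ^ r) := by
        rw [measureReal_restrict_apply (measurableSet_above a).compl, Set.inter_comm,
          ← Set.sdiff_eq]
        refine (measureReal_mono (Set.sdiff_subset_sdiff_right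
          (fun x hx => hx.1 : gap r a 1 ⊆ above r a))).trans ?_
        rw [measureReal_sdiff (fun y hy => haS hy.1) (measurableSet_gap a 1),
          unifCube_gap ha ha1 le_rfl]
        nlinarith [Real.add_one_le_exp (-(1 - a) ^ r)]
      have heq : {ω : Fin (n + 1) → Fin r → ℝ | ∀ j, ω j ∉ above r a} =
          Set.univ.pi fun _ => (above r a)ᶜ := by
        ext ω
        simp
      rw [heq, Measure.pi_pi, Finset.prod_const, Finset.card_univ, Fintype.card_fin,
        ← ofReal_measureReal, ← ENNReal.ofReal_pow measureReal_nonneg]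
      refine ENNReal.ofReal_le_ofReal ?_
      calc _ ≤ ((unifCube r).restrict S).real (above r a)ᶜ ^ m :=
            pow_le_pow_of_le_one measureReal_nonneg
              (ENNReal.toReal_mono ENNReal.one_ne_top
                ((Measure.restrict_le_self _).trans prob_le_one)) (by omega)
        _ ≤ (M * Real.exp (-(1 - a) ^ r)) ^ m := by gcongr
        _ = M ^ m * Real.exp (-(m * (1 - a) ^ r)) := by
            rw [mul_pow, ← Real.exp_nat_mul, mul_neg]
        _ ≤ M ^ m * (C * Real.exp (κ * (1 - a))) := by
            gcongr
            exact hC _ (sub_nonneg.2 ha1) (by linarith)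
        _ = _ := by ring
    calc _ ≤ _ := measure_union_le _ _
      _ ≤ _ := add_le_add hnone hstep
      _ ≤ _ := by
          rw [← ENNReal.ofReal_add (by positivity) (by positivity)]
          refine ENNReal.ofReal_le_ofReal ?_
          have hnq : ((n + 1 : ℕ) : ℝ) * G ≤ q := by
            refine le_trans ?_ hNq
            have : ((n + 1 : ℕ) : ℝ) ≤ N := by exact_mod_cast hN
            gcongr
          have hq1 : 1 ≤ q ^ (k + 1) := one_le_pow₀ hq
          set E := M ^ m * Real.exp (κ * (1 - a))
          have hE : 0 ≤ E := by positivity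
          calc C * E + ((n + 1 : ℕ) : ℝ) * G * (C * k * q ^ k) * E
              ≤ C * E * q ^ (k + 1) + q * (C * k * q ^ k) * E :=
                add_le_add (le_mul_of_one_le_right (by positivity) hq1) (by gcongr)
            _ = _ := by push_cast; ring

end GreedyBounds

section MaxCoordLaw

variable {r : ℕ}

theorem map_maxCoord_restrict_above [NeZero r] :
    (volume.restrict (above r 0)).map maxCoord =
      (volume.restrict (Set.Ioi 0)).withDensity fun u => ENNReal.ofReal (r * u ^ (r - 1)) := by
  have hlhs (b : ℝ) : (volume.restrict (above r 0)).map maxCoord (Set.Iic b) =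
      ENNReal.ofReal b ^ r := by
    rw [Measure.map_apply measurable_maxCoord measurableSet_Iic,
      Measure.restrict_apply (measurable_maxCoord measurableSet_Iic)]
    have : maxCoord ⁻¹' Set.Iic b ∩ above r 0 = Set.Icc (fun _ => 0) fun _ => b := by
      ext x
      simp only [Set.mem_inter_iff, Set.mem_preimage, Set.mem_Iic, maxCoord_le_iff, Set.mem_Icc,
        Pi.le_def]
      exact and_comm
    rw [this, Real.volume_Icc_pi]
    simp
  have hrhs (b : ℝ) : ((volume.restrict (Set.Ioi 0)).withDensity fun u =>
      ENNReal.ofReal (r * u ^ (r - 1))) (Set.Iic b) = ENNReal.ofReal b ^ r := by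
    have hr := NeZero.ne r
    rw [withDensity_apply _ measurableSet_Iic, Measure.restrict_restrict measurableSet_Iic,
      Set.inter_comm, Set.Ioi_inter_Iic]
    rcases le_total b 0 with hb | hb
    · simp [Set.Ioc_eq_empty (not_lt.2 hb), ENNReal.ofReal_of_nonpos hb, hr]
    · rw [← ofReal_integral_eq_lintegral_ofReal, ← intervalIntegral.integral_of_le hb,
        intervalIntegral.integral_const_mul, integral_pow, ← ENNReal.ofReal_pow hb]
      · congr 1
        have h1 : r - 1 + 1 = r := Nat.succ_pred_eq_of_ne_zero hr
        have h2 : ((r - 1 : ℕ) : ℝ) + 1 = r := by exact_mod_cast h1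
        rw [h1, h2, zero_pow hr, sub_zero]
        field_simp
      · exact (Continuous.integrableOn_Icc (by fun_prop)).mono_set Set.Ioc_subset_Icc_self
      · filter_upwards [ae_restrict_mem measurableSet_Ioc] with u hu
        have := hu.1.le
        exact mul_nonneg r.cast_nonneg (pow_nonneg this _)
  refine Measure.ext_of_generateFrom_of_iUnion (Set.range Set.Iic) (fun n : ℕ => Set.Iic (n : ℝ))
    (borel_eq_generateFrom_Iic ℝ ▸ BorelSpace.measurable_eq) isPiSystem_Iic ?_ (fun n => ⟨n, rfl⟩)
    (fun n => ?_) ?_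
  · exact Set.eq_univ_of_forall fun x => Set.mem_iUnion.2 (exists_nat_ge x)
  · rw [hlhs]
    exact ENNReal.pow_ne_top ENNReal.ofReal_ne_top
  · rintro _ ⟨b, rfl⟩
    exact (hlhs b).trans (hrhs b).symm

theorem lintegral_above_maxCoord [NeZero r] {f : ℝ → ENNReal} (hf : Measurable f) (a : ℝ) :
    ∫⁻ x in above r a, f (maxCoord x - a) =
      ∫⁻ u in Set.Ioi 0, ENNReal.ofReal (r * u ^ (r - 1)) * f u := by
  have hmax (x : Fin r → ℝ) : maxCoord (fun l => x l + a) = maxCoord x + a := by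
    refine le_antisymm (maxCoord_le_iff.2 fun l => add_le_add_left (le_maxCoord x l) a) ?_
    obtain ⟨l, hl⟩ := exists_eq_maxCoord x
    exact hl ▸ le_maxCoord (fun l => x l + a) l
  calc _ = ∫⁻ x, (above r a).indicator (fun x => f (maxCoord x - a)) x := by
        rw [lintegral_indicator (measurableSet_above a)]
    _ = ∫⁻ x : Fin r → ℝ,
          (above r a).indicator (fun x => f (maxCoord x - a)) (x + fun _ => a) :=
        (lintegral_add_right_eq_self _ _).symm
    _ = ∫⁻ x in above r 0, f (maxCoord x) := by
        rw [← lintegral_indicator (measurableSet_above 0)]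
        refine lintegral_congr fun x => ?_
        have hmem : (x + fun _ => a) ∈ above r a ↔ x ∈ above r 0 := by simp [above]
        have hval : maxCoord (x + fun _ => a) = maxCoord x + a := hmax x
        by_cases hx : x ∈ above r 0
        · rw [Set.indicator_of_mem hx, Set.indicator_of_mem (hmem.2 hx), hval,
            add_sub_cancel_right]
        · rw [Set.indicator_of_notMem hx, Set.indicator_of_notMem (hmem.not.2 hx)]
    _ = ∫⁻ u, f u ∂(volume.restrict (above r 0)).map maxCoord :=
        (lintegral_map hf measurable_maxCoord).symm
    _ = _ := by
        rw [map_maxCoord_restrict_above, lintegral_withDensity_eq_lintegral_mul _ (by fun_prop) hf]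
        rfl

end MaxCoordLaw

section Weibull

variable {r : ℕ}

/-- The Weibull law of shape `r`, with density `r u^(r-1) exp(-u^r)` on the positive reals. -/
noncomputable def weibull (r : ℕ) : Measure ℝ :=
  (volume.restrict (Set.Ioi 0)).withDensity fun u =>
    ENNReal.ofReal (r * u ^ (r - 1) * Real.exp (-u ^ r))

theorem integrableOn_weibull_exp (hr : 2 ≤ r) (t : ℝ) :
    IntegrableOn (fun u : ℝ => r * u ^ (r - 1) * Real.exp (t * u - u ^ r)) (Set.Ioi 0) := by
  have hbase := (integrableOn_rpow_mul_exp_neg_mul_rpow (p := r) (s := (r - 1 : ℕ)) (b := 1 / 2)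
    (by have : (0 : ℝ) ≤ (r - 1 : ℕ) := Nat.cast_nonneg _
        linarith) (by exact_mod_cast (show 0 < r by omega)) (by norm_num)).const_mul
    (r * Real.exp (t ^ 2 / 2 + 1 / 2))
  refine Integrable.mono' hbase (by fun_prop) ?_
  filter_upwards [ae_restrict_mem measurableSet_Ioi] with u hu
  have hu0 : (0 : ℝ) < u := hu
  have hsq : u ^ 2 ≤ u ^ r + 1 := by
    rcases le_total u 1 with h | h
    · nlinarith [pow_nonneg hu0.le r]
    · linarith [pow_le_pow_right₀ h hr]
  rw [Real.norm_of_nonneg (by positivity), Real.rpow_natCast, Real.rpow_natCast]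
  calc _ ≤ r * u ^ (r - 1) * Real.exp ((t ^ 2 / 2 + 1 / 2) + -(1 / 2) * u ^ r) := by
        gcongr
        nlinarith [sq_nonneg (t - u)]
    _ = _ := by
        rw [Real.exp_add]
        ring

theorem integral_weibull (r : ℕ) (f : ℝ → ℝ) :
    ∫ u, f u ∂weibull r = ∫ u in Set.Ioi 0, r * u ^ (r - 1) * Real.exp (-u ^ r) * f u := by
  rw [weibull, integral_withDensity_eq_integral_toReal_smul (by fun_prop)
    (Filter.Eventually.of_forall fun _ => ENNReal.ofReal_lt_top)]
  refine setIntegral_congr_fun measurableSet_Ioi fun u hu => ?_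
  have hu0 : (0 : ℝ) < u := hu
  rw [ENNReal.toReal_ofReal (by positivity), smul_eq_mul]

theorem integrable_weibull_exp (hr : 2 ≤ r) (t : ℝ) :
    Integrable (fun u => Real.exp (t * u)) (weibull r) := by
  rw [weibull, integrable_withDensity_iff_integrable_smul' (by fun_prop)
    (Filter.Eventually.of_forall fun _ => ENNReal.ofReal_lt_top)]
  refine (integrableOn_weibull_exp hr t).congr_fun (fun u hu => ?_) measurableSet_Ioi
  have hu0 : (0 : ℝ) < u := hu
  simp only
  rw [ENNReal.toReal_ofReal (by positivity), smul_eq_mul, mul_assoc _ (Real.exp _),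
    ← Real.exp_add, neg_add_eq_sub]

theorem mgf_weibull (r : ℕ) (t : ℝ) : ProbabilityTheory.mgf id (weibull r) t =
    ∫ u in Set.Ioi 0, r * u ^ (r - 1) * Real.exp (t * u - u ^ r) := by
  rw [ProbabilityTheory.mgf, integral_weibull]
  refine setIntegral_congr_fun measurableSet_Ioi fun u _ => ?_
  simp only [id]
  rw [mul_assoc _ (Real.exp _), ← Real.exp_add, neg_add_eq_sub]

theorem integral_pow_mul_exp_neg_pow [NeZero r] (q : ℕ) :
    ∫ u : ℝ in Set.Ioi 0, u ^ q * Real.exp (-u ^ r) = 1 / r * Real.Gamma ((q + 1) / r) := by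
  have hr : (0 : ℝ) < r := by exact_mod_cast NeZero.pos r
  have hq : (-1 : ℝ) < q := by
    have : (0 : ℝ) ≤ q := q.cast_nonneg
    linarith
  simpa only [Real.rpow_natCast] using integral_rpow_mul_exp_neg_rpow hr hq

theorem mgf_weibull_zero [NeZero r] : ProbabilityTheory.mgf id (weibull r) 0 = 1 := by
  have hr : (r : ℝ) ≠ 0 := by exact_mod_cast NeZero.ne r
  have h1 : ((r - 1 : ℕ) : ℝ) + 1 = r := by exact_mod_cast Nat.succ_pred_eq_of_ne_zero (NeZero.ne r)
  simp only [mgf_weibull, zero_mul, zero_sub, mul_assoc]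
  rw [integral_const_mul, integral_pow_mul_exp_neg_pow, h1, div_self hr, Real.Gamma_one]
  field_simp

theorem integral_id_weibull [NeZero r] : ∫ u, u ∂weibull r = Real.Gamma (1 / r) / r := by
  have hr : (r : ℝ) ≠ 0 := by exact_mod_cast NeZero.ne r
  have hr0 : r ≠ 0 := NeZero.ne r
  rw [integral_weibull]
  have : ∀ u : ℝ, r * u ^ (r - 1) * Real.exp (-u ^ r) * u = r * (u ^ r * Real.exp (-u ^ r)) := by
    intro u
    rw [← mul_pow_sub_one hr0 u]
    ring
  simp only [this]
  rw [integral_const_mul, integral_pow_mul_exp_neg_pow, add_div, div_self hr, add_comm,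
    Real.Gamma_add_one (one_div_ne_zero hr)]
  field_simp

theorem hasDerivAt_log_mgf_weibull (hr : 2 ≤ r) :
    HasDerivAt (fun t => Real.log (ProbabilityTheory.mgf id (weibull r) t))
      (Real.Gamma (1 / r) / r) 0 := by
  have : NeZero r := ⟨by omega⟩
  have huniv : ProbabilityTheory.integrableExpSet id (weibull r) = Set.univ :=
    Set.eq_univ_of_forall fun t => integrable_weibull_exp hr t
  have h := ProbabilityTheory.hasDerivAt_mgf (X := id) (μ := weibull r) (t := 0)
    (by rw [huniv, interior_univ]; trivial)
  have h' := h.log (by rw [mgf_weibull_zero]; exact one_ne_zero)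
  rw [mgf_weibull_zero, div_one] at h'
  simpa [integral_id_weibull] using h'

theorem mgf_weibull_pos (hr : 2 ≤ r) (t : ℝ) : 0 < ProbabilityTheory.mgf id (weibull r) t := by
  have : NeZero r := ⟨by omega⟩
  refine ProbabilityTheory.mgf_pos' (fun h => ?_) (integrable_weibull_exp hr t)
  have h1 := mgf_weibull_zero (r := r)
  simp [h, ProbabilityTheory.mgf] at h1

theorem lintegral_above_exp_le (hr : 2 ≤ r) {m : ℕ} (hm : 0 < m) (t a : ℝ) :
    ∫⁻ x in above r a, ENNReal.ofReal (Real.exp (t * (m : ℝ) ^ (1 / (r : ℝ)) * (maxCoord x - a) -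
        m * (maxCoord x - a) ^ r)) ∂unifCube r ≤
      ENNReal.ofReal (ProbabilityTheory.mgf id (weibull r) t / m) := by
  have : NeZero r := ⟨by omega⟩
  set c : ℝ := (m : ℝ) ^ (1 / (r : ℝ))
  have hm' : (0 : ℝ) < m := by exact_mod_cast hm
  have hc : 0 < c := Real.rpow_pos_of_pos hm' _
  have hcr : c ^ r = m := by
    simp only [c, one_div]
    exact Real.rpow_inv_natCast_pow hm'.le (NeZero.ne r)
  have hcr' : c * c ^ (r - 1) = m := by rw [mul_pow_sub_one (NeZero.ne r), hcr]
  set g : ℝ → ℝ := fun u => r * u ^ (r - 1) * Real.exp (t * u - u ^ r)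
  have hg : ∀ u : ℝ, r * u ^ (r - 1) * Real.exp (t * c * u - m * u ^ r) =
      (c ^ (r - 1))⁻¹ * g (c * u) := by
    intro u
    simp only [g]
    rw [mul_pow, mul_pow, hcr, ← mul_assoc t]
    field_simp
  have hint : IntegrableOn (fun u => (c ^ (r - 1))⁻¹ * g (c * u)) (Set.Ioi 0) := by
    refine Integrable.const_mul ?_ _
    have := (integrableOn_Ioi_comp_mul_left_iff g 0 hc).2
    rw [mul_zero] at this
    exact this (integrableOn_weibull_exp hr t)
  calc _ ≤ ∫⁻ x in above r a, ENNReal.ofReal (Real.exp (t * c * (maxCoord x - a) -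
        m * (maxCoord x - a) ^ r)) := by
        refine lintegral_mono' (Measure.restrict_mono le_rfl ?_) le_rfl
        rw [unifCube_eq_restrict]
        exact Measure.restrict_le_self
    _ = ∫⁻ u in Set.Ioi 0, ENNReal.ofReal ((c ^ (r - 1))⁻¹ * g (c * u)) := by
        rw [lintegral_above_maxCoord
          (f := fun s => ENNReal.ofReal (Real.exp (t * c * s - m * s ^ r))) (by fun_prop)]
        refine setLIntegral_congr_fun measurableSet_Ioi fun u hu => ?_
        have hu0 : (0 : ℝ) < u := hu
        rw [← ENNReal.ofReal_mul (by positivity), hg]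
    _ = ENNReal.ofReal (ProbabilityTheory.mgf id (weibull r) t / m) := by
        rw [← ofReal_integral_eq_lintegral_ofReal hint, integral_const_mul,
          integral_comp_mul_left_Ioi g 0 hc, mul_zero, mgf_weibull, ← hcr', smul_eq_mul]
        · congr 1
          field_simp
          rfl
        · filter_upwards [ae_restrict_mem measurableSet_Ioi] with u hu
          have hu0 : (0 : ℝ) < u := hu
          simp only [Pi.zero_apply, g]
          positivity

end Weibull

section Tail

variable {r n : ℕ}

theorem ae_pointsMeasure_mem_above_zero (r n : ℕ) [NeZero r] :
    ∀ᵐ ω ∂pointsMeasure r n, ∀ i, ω i ∈ above r 0 := by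
  refine ae_all_iff.2 fun i => ?_
  have h := (measurePreserving_eval (fun _ : Fin n => unifCube r) i).quasiMeasurePreserving.ae
    (ae_unifCube_mem_Icc r)
  filter_upwards [h] with ω hω l
  exact (hω l).1

theorem ae_pointsMeasure_injective (r n : ℕ) [NeZero r] :
    ∀ᵐ ω ∂pointsMeasure r n, Function.Injective ω := by
  have key : ∀ i j : Fin n, i ≠ j → ∀ᵐ ω ∂pointsMeasure r n, ω i ≠ ω j := by
    intro i j hij
    have hind := ProbabilityTheory.iIndepFun_pi (μ := fun _ : Fin n => unifCube r)
      (X := fun _ => id) (fun _ => aemeasurable_id)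
    have hp := (ProbabilityTheory.indepFun_iff_map_prod_eq_prod_map_map
      (measurable_pi_apply i).aemeasurable (measurable_pi_apply j).aemeasurable).1
      (hind.indepFun hij)
    rw [show (fun ω : Fin n → Fin r → ℝ => ω i) = Function.eval i from rfl,
      show (fun ω : Fin n → Fin r → ℝ => ω j) = Function.eval j from rfl,
      (measurePreserving_eval (fun _ : Fin n => unifCube r) i).map_eq,
      (measurePreserving_eval (fun _ : Fin n => unifCube r) j).map_eq] at hp
    have hatom : NullSingletonClass (unifCube r) := by
      unfold unifCube
      infer_instance
    have hdiag : ∀ᵐ p ∂(unifCube r).prod (unifCube r), p.1 ≠ p.2 := by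
      refine (Measure.ae_prod_iff_ae_ae ?_).2 (ae_of_all _ fun x => ?_)
      · exact (measurableSet_eq_fun measurable_fst measurable_snd).compl
      · filter_upwards [compl_mem_ae_iff.2 (measure_singleton x)] with y hy h
        exact hy h.symm
    rw [← hp] at hdiag
    exact ae_of_ae_map (f := fun ω : Fin n → Fin r → ℝ => (ω i, ω j)) (by fun_prop) hdiag
  have : ∀ᵐ ω ∂pointsMeasure r n, ∀ i j : Fin n, i ≠ j → ω i ≠ ω j := by
    simpa only [ae_all_iff] using key
  filter_upwards [this] with ω hω i j h
  by_contra hij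
  exact hω i j hij h

/-- Chernoff-type bound for the probability that a long chain exists. -/
theorem pointsMeasure_le_chainLenSingle_le (hr : 2 ≤ r) {k m : ℕ} (hn : n = m + k) (hm : 0 < m)
    {t : ℝ} (ht : t ≤ 0) :
    pointsMeasure r n {ω | k ≤ chainLenSingle ω} ≤
      ENNReal.ofReal ((n * (ProbabilityTheory.mgf id (weibull r) t / m)) ^ k *
        Real.exp (-t * (m : ℝ) ^ (1 / (r : ℝ)))) := by
  have : NeZero r := ⟨by omega⟩
  have hG0 : 0 ≤ ProbabilityTheory.mgf id (weibull r) t / m :=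
    div_nonneg (mgf_weibull_pos hr t).le m.cast_nonneg
  have h := pi_restrict_greedyReach_le (r := r) (m := m) (k := k) (N := n) (n := n)
    (κ := -t * (m : ℝ) ^ (1 / (r : ℝ))) (a := 0) (S := Set.univ)
    (mul_nonneg (neg_nonneg.2 ht) (by positivity)) hG0
    (fun a _ => by
      refine le_trans (le_of_eq ?_) (lintegral_above_exp_le hr hm t a)
      simp only [neg_mul, neg_neg]) hn le_rfl le_rfl zero_le_one MeasurableSet.univ
    (Set.subset_univ _)
  simp only [Measure.restrict_univ, probReal_univ, one_pow, one_mul, sub_zero, mul_one] at h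
  refine le_trans (measure_mono_ae ?_) h
  filter_upwards [ae_pointsMeasure_mem_above_zero r n] with ω hω hk
  exact hasIndexChain_mem_greedyReach (hasIndexChain_of_le_chainLenSingle hω hk)

theorem exp_neg_mul_pow_le (hr : 2 ≤ r) (m : ℕ) (t : ℝ) {u : ℝ} (hu : 0 ≤ u) :
    Real.exp (-(m * u ^ r)) ≤
      Real.exp (t ^ 2 / 4 + 1) * Real.exp (-t * (m : ℝ) ^ (1 / (r : ℝ)) * u) := by
  have : NeZero r := ⟨by omega⟩
  rw [← Real.exp_add, Real.exp_le_exp]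
  set c : ℝ := (m : ℝ) ^ (1 / (r : ℝ))
  have hc : 0 ≤ c := Real.rpow_nonneg m.cast_nonneg _
  have hcr : c ^ r = m := by
    simp only [c, one_div]
    exact Real.rpow_inv_natCast_pow m.cast_nonneg (NeZero.ne r)
  have hv : 0 ≤ c * u := mul_nonneg hc hu
  have hsq : (c * u) ^ 2 ≤ (c * u) ^ r + 1 := by
    rcases le_total (c * u) 1 with h | h
    · nlinarith [pow_nonneg hv r]
    · linarith [pow_le_pow_right₀ h hr]
  rw [← hcr, ← mul_pow]
  nlinarith [sq_nonneg (c * u - t / 2)]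

theorem one_le_mgf_weibull (hr : 2 ≤ r) {t : ℝ} (ht : 0 ≤ t) :
    1 ≤ ProbabilityTheory.mgf id (weibull r) t := by
  have : NeZero r := ⟨by omega⟩
  rw [← mgf_weibull_zero (r := r)]
  have hpos : ∀ᵐ u ∂weibull r, 0 < u :=
    (withDensity_absolutelyContinuous _ _).ae_le (ae_restrict_mem measurableSet_Ioi)
  refine integral_mono_ae (integrable_weibull_exp hr 0) (integrable_weibull_exp hr t) ?_
  filter_upwards [hpos] with u hu
  simp only [id]
  gcongr

/-- Chernoff-type bound for the probability that no long chain exists. -/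
theorem pointsMeasure_chainLenSingle_lt_le (hr : 2 ≤ r) {k m : ℕ} (hn : n = m + k) (hm : 0 < m)
    {t : ℝ} (ht : 0 ≤ t) :
    pointsMeasure r n {ω | chainLenSingle ω < k} ≤
      ENNReal.ofReal (Real.exp (t ^ 2 / 4 + 1) * k *
        ((n * (ProbabilityTheory.mgf id (weibull r) t / m)) ^ k *
          Real.exp (-t * (m : ℝ) ^ (1 / (r : ℝ))))) := by
  have : NeZero r := ⟨by omega⟩
  have hG0 : 0 ≤ ProbabilityTheory.mgf id (weibull r) t / m :=
    div_nonneg (mgf_weibull_pos hr t).le m.cast_nonneg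
  have hq : 1 ≤ n * (ProbabilityTheory.mgf id (weibull r) t / m) := by
    have hm' : (0 : ℝ) < m := by exact_mod_cast hm
    have hmn : (m : ℝ) ≤ n := by exact_mod_cast (show m ≤ n by omega)
    rw [← mul_div_assoc, one_le_div hm']
    nlinarith [one_le_mgf_weibull hr ht]
  have h := pi_restrict_greedyStop_le (r := r) (m := m) (k := k) (N := n) (n := n)
    (κ := -t * (m : ℝ) ^ (1 / (r : ℝ))) (a := 0) (S := Set.univ)
    (Real.exp_nonneg (t ^ 2 / 4 + 1)) hG0 hq le_rfl
    (fun u hu _ => exp_neg_mul_pow_le hr m t hu)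
    (fun a _ => by
      refine le_trans (le_of_eq ?_) (lintegral_above_exp_le hr hm t a)
      simp only [neg_mul, neg_neg]) hn.ge le_rfl le_rfl zero_le_one MeasurableSet.univ
    (Set.subset_univ _)
  simp only [Measure.restrict_univ, probReal_univ, one_pow, one_mul, sub_zero, mul_one] at h
  rw [mul_assoc _ (_ ^ k)] at h
  refine le_trans (measure_mono_ae ?_) h
  filter_upwards [ae_pointsMeasure_injective r n] with ω hω hk
  exact mem_greedyStop_of_not_hasIndexChain fun hc =>
    (le_chainLenSingle_of_hasIndexChain hω hc).not_gt hk

end Tail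

section Limit

open Filter Topology

theorem exists_neg_lt_zero_of_hasDerivAt {f : ℝ → ℝ} {f' : ℝ} (hf : HasDerivAt f f' 0)
    (h0 : f 0 = 0) (hf' : 0 < f') : ∃ t < 0, f t < 0 := by
  have h := (hasDerivAt_iff_tendsto_slope.1 hf).mono_left
    (nhdsWithin_mono 0 fun t (ht : t ∈ Set.Iio 0) => ht.ne)
  obtain ⟨t, ht, ht0⟩ := ((h.eventually_const_lt hf').and self_mem_nhdsWithin).exists
  have ht0 : t < 0 := ht0
  refine ⟨t, ht0, ?_⟩
  rw [slope_def_field, h0, sub_zero, sub_zero] at ht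
  by_contra! hc
  exact ht.not_ge (div_nonpos_of_nonneg_of_nonpos hc ht0.le)

variable {r : ℕ}

theorem exists_neg_mul_log_mgf_weibull_sub_lt_zero (hr : 2 ≤ r) {c : ℝ}
    (hc : 1 < c * (Real.Gamma (1 / r) / r)) :
    ∃ t < 0, c * Real.log (ProbabilityTheory.mgf id (weibull r) t) - t < 0 := by
  have : NeZero r := ⟨by omega⟩
  exact exists_neg_lt_zero_of_hasDerivAt
    (f := fun t => c * Real.log (ProbabilityTheory.mgf id (weibull r) t) - t)
    (((hasDerivAt_log_mgf_weibull hr).const_mul c).sub (hasDerivAt_id' 0))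
    (by simp only [mgf_weibull_zero, Real.log_one, mul_zero, sub_zero]) (sub_pos.2 hc)

theorem exists_pos_mul_log_mgf_weibull_sub_lt_zero (hr : 2 ≤ r) {c : ℝ}
    (hc : c * (Real.Gamma (1 / r) / r) < 1) :
    ∃ t > 0, c * Real.log (ProbabilityTheory.mgf id (weibull r) t) - t < 0 := by
  have : NeZero r := ⟨by omega⟩
  have h := ((hasDerivAt_log_mgf_weibull hr).const_mul c).sub (hasDerivAt_id' 0)
  obtain ⟨t, ht, hlt⟩ := exists_neg_lt_zero_of_hasDerivAt
    (f := fun t => c * Real.log (ProbabilityTheory.mgf id (weibull r) (-t)) - -t)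
    (f' := -(c * (Real.Gamma (1 / r) / r) - 1))
    (by
      have hneg := hasDerivAt_neg' (0 : ℝ)
      rw [← neg_zero] at h
      have hcomp := h.comp (0 : ℝ) hneg
      rw [mul_neg_one] at hcomp
      exact hcomp)
    (by simp only [neg_zero, mgf_weibull_zero, Real.log_one, mul_zero, sub_zero]) (by linarith)
  exact ⟨-t, by linarith, hlt⟩

theorem tendsto_natCast_rpow_inv_atTop (hr : r ≠ 0) :
    Tendsto (fun n : ℕ => (n : ℝ) ^ (1 / (r : ℝ))) atTop atTop :=
  (tendsto_rpow_atTop (by positivity)).comp tendsto_natCast_atTop_atTop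

theorem tendsto_ceil_div_rpow (hr : r ≠ 0) {c : ℝ} (hc : 0 < c) :
    Tendsto (fun n : ℕ => (⌈c * (n : ℝ) ^ (1 / (r : ℝ))⌉₊ : ℝ) / (n : ℝ) ^ (1 / (r : ℝ)))
      atTop (𝓝 c) :=
  (tendsto_nat_ceil_mul_div_atTop hc.le).comp (tendsto_natCast_rpow_inv_atTop hr)

theorem tendsto_ceil_div (hr : 2 ≤ r) {c : ℝ} (hc : 0 < c) :
    Tendsto (fun n : ℕ => (⌈c * (n : ℝ) ^ (1 / (r : ℝ))⌉₊ : ℝ) / n) atTop (𝓝 0) := by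
  have hr' : (2 : ℝ) ≤ r := by exact_mod_cast hr
  have hexp : 0 < 1 - 1 / (r : ℝ) := by
    rw [sub_pos, div_lt_one (by linarith)]
    linarith
  have h1 : Tendsto (fun n : ℕ => (n : ℝ) ^ (-(1 - 1 / (r : ℝ)))) atTop (𝓝 0) :=
    (tendsto_rpow_neg_atTop hexp).comp tendsto_natCast_atTop_atTop
  have h2 := (tendsto_ceil_div_rpow (by omega : r ≠ 0) hc).mul h1
  rw [mul_zero] at h2
  refine h2.congr' ?_
  filter_upwards [eventually_gt_atTop 0] with n hn
  have hn' : (0 : ℝ) < n := by exact_mod_cast hn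
  rw [neg_sub, Real.rpow_sub_one hn'.ne']
  have := (Real.rpow_pos_of_pos hn' (1 / (r : ℝ))).ne'
  field_simp

theorem eventually_ceil_lt (hr : 2 ≤ r) {c : ℝ} (hc : 0 < c) :
    ∀ᶠ n : ℕ in atTop, ⌈c * (n : ℝ) ^ (1 / (r : ℝ))⌉₊ < n := by
  filter_upwards [(tendsto_ceil_div hr hc).eventually_lt_const one_pos, eventually_gt_atTop 0]
    with n h hn
  have hn' : (0 : ℝ) < n := by exact_mod_cast hn
  exact_mod_cast (div_lt_one hn').1 h

theorem tendsto_mul_exp_mul_atTop {ι : Type*} {l : Filter ι} {s y : ι → ℝ} {b : ℝ}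
    (hs : Tendsto s l atTop) (hy : Tendsto y l (𝓝 b)) (hb : b < 0) :
    Tendsto (fun i => s i * Real.exp (s i * y i)) l (𝓝 0) := by
  have h1 : Tendsto (fun x : ℝ => x * Real.exp (-(-b / 2 * x))) atTop (𝓝 0) := by
    have := Real.tendsto_pow_mul_exp_neg_atTop_nhds_zero 1
    have h2 := (this.comp (tendsto_id.const_mul_atTop (show 0 < -b / 2 by linarith))).const_mul
      (-b / 2)⁻¹
    rw [mul_zero] at h2
    refine h2.congr fun x => ?_
    simp only [Function.comp, id, pow_one]
    rw [← mul_assoc, inv_mul_cancel_left₀ (by linarith)]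
  refine tendsto_of_tendsto_of_tendsto_of_le_of_le' tendsto_const_nhds (h1.comp hs) ?_ ?_
  · filter_upwards [hs.eventually_ge_atTop 0] with i hi
    positivity
  · filter_upwards [hs.eventually_ge_atTop 0, hy.eventually_lt_const (show b < b / 2 by linarith)]
      with i hi hlt
    refine mul_le_mul_of_nonneg_left (Real.exp_le_exp.2 ?_) hi
    nlinarith

theorem tendsto_chernoff_bound (hr : 2 ≤ r) {c t φ : ℝ} (hc : 0 < c) (hφ : 0 < φ)
    (h : c * Real.log φ - t < 0) {k : ℕ → ℕ} (hk : ∀ n, k n = ⌈c * (n : ℝ) ^ (1 / (r : ℝ))⌉₊) :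
    Tendsto (fun n : ℕ => (k n : ℝ) * ((n * (φ / (n - k n : ℕ))) ^ k n *
      Real.exp (-t * ((n - k n : ℕ) : ℝ) ^ (1 / (r : ℝ))))) atTop (𝓝 0) := by
  set s := fun n : ℕ => (n : ℝ) ^ (1 / (r : ℝ))
  have hs : Tendsto s atTop atTop := tendsto_natCast_rpow_inv_atTop (by omega)
  have hks : Tendsto (fun n => (k n : ℝ) / s n) atTop (𝓝 c) := by
    simpa only [hk] using tendsto_ceil_div_rpow (by omega) hc
  have hx : Tendsto (fun n : ℕ => 1 - (k n : ℝ) / n) atTop (𝓝 1) := by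
    simpa only [hk, sub_zero] using (tendsto_ceil_div hr hc).const_sub 1
  set x := fun n : ℕ => 1 - (k n : ℝ) / n
  have hy : Tendsto (fun n => k n / s n * (Real.log φ - Real.log (x n)) -
      t * x n ^ (1 / (r : ℝ))) atTop (𝓝 (c * Real.log φ - t)) := by
    have h1 := (hks.mul ((hx.log one_ne_zero).const_sub (Real.log φ))).sub
      ((hx.rpow_const (p := 1 / (r : ℝ)) (.inl one_ne_zero)).const_mul t)
    simpa using h1
  have hlim := hks.mul (tendsto_mul_exp_mul_atTop hs hy h)
  rw [mul_zero] at hlim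
  refine hlim.congr' ?_
  filter_upwards [eventually_ceil_lt hr hc, eventually_gt_atTop 0] with n hkn hn
  have hn' : (0 : ℝ) < n := by exact_mod_cast hn
  have hsn : 0 < s n := Real.rpow_pos_of_pos hn' _
  have hkn' : k n < n := (hk n).trans_lt hkn
  have hkn'' : (k n : ℝ) < n := by exact_mod_cast hkn'
  have hxn : 0 < x n := by
    simp only [x]
    rw [sub_pos, div_lt_one hn']
    exact hkn''
  have hm : ((n - k n : ℕ) : ℝ) = n * x n := by
    rw [Nat.cast_sub hkn'.le]
    simp only [x]
    field_simp
  rw [hm, Real.mul_rpow hn'.le hxn.le, show (n : ℝ) * (φ / (n * x n)) = φ / x n by field_simp,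
    ← Real.exp_log (div_pos hφ hxn), ← Real.exp_nat_mul, ← Real.exp_add,
    Real.log_div hφ.ne' hxn.ne', ← mul_assoc, div_mul_cancel₀ _ hsn.ne']
  congr 2
  rw [mul_sub, ← mul_assoc, mul_div_cancel₀ _ hsn.ne']
  ring

end Limit

section Convergence

open Filter Topology

variable {r : ℕ}

theorem tendsto_pointsMeasure_le_chainLenSingle (hr : 2 ≤ r) {c : ℝ}
    (hc : 1 < c * (Real.Gamma (1 / r) / r)) :
    Tendsto (fun n : ℕ => pointsMeasure r n
      {ω | ⌈c * (n : ℝ) ^ (1 / (r : ℝ))⌉₊ ≤ chainLenSingle ω}) atTop (𝓝 0) := by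
  have hw : 0 ≤ Real.Gamma (1 / r) / r :=
    div_nonneg (Real.Gamma_nonneg_of_nonneg (by positivity)) r.cast_nonneg
  have hc0 : 0 < c := pos_of_mul_pos_left (one_pos.trans hc) hw
  obtain ⟨t, ht, hlt⟩ := exists_neg_mul_log_mgf_weibull_sub_lt_zero hr hc
  have hlim := ENNReal.tendsto_ofReal
    (tendsto_chernoff_bound hr hc0 (mgf_weibull_pos hr t) hlt fun _ => rfl)
  rw [ENNReal.ofReal_zero] at hlim
  refine tendsto_of_tendsto_of_tendsto_of_le_of_le' tendsto_const_nhds hlim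
    (Eventually.of_forall fun _ => zero_le) ?_
  filter_upwards [eventually_ceil_lt hr hc0, eventually_gt_atTop 0] with n hkn hn
  refine (pointsMeasure_le_chainLenSingle_le hr (Nat.sub_add_cancel hkn.le).symm
    (Nat.sub_pos_of_lt hkn) ht.le).trans (ENNReal.ofReal_le_ofReal ?_)
  have hk : (1 : ℝ) ≤ ⌈c * (n : ℝ) ^ (1 / (r : ℝ))⌉₊ := by
    have hn' : (0 : ℝ) < n := by exact_mod_cast hn
    exact_mod_cast Nat.ceil_pos.2 (mul_pos hc0 (Real.rpow_pos_of_pos hn' _))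
  have hφ := mgf_weibull_pos hr t
  exact le_mul_of_one_le_left (by positivity) hk

theorem tendsto_pointsMeasure_chainLenSingle_lt (hr : 2 ≤ r) {c : ℝ} (hc0 : 0 < c)
    (hc : c * (Real.Gamma (1 / r) / r) < 1) :
    Tendsto (fun n : ℕ => pointsMeasure r n
      {ω | chainLenSingle ω < ⌈c * (n : ℝ) ^ (1 / (r : ℝ))⌉₊}) atTop (𝓝 0) := by
  obtain ⟨t, ht, hlt⟩ := exists_pos_mul_log_mgf_weibull_sub_lt_zero hr hc
  have hlim := ENNReal.tendsto_ofReal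
    ((tendsto_chernoff_bound hr hc0 (mgf_weibull_pos hr t) hlt fun _ => rfl).const_mul
      (Real.exp (t ^ 2 / 4 + 1)))
  rw [mul_zero, ENNReal.ofReal_zero] at hlim
  refine tendsto_of_tendsto_of_tendsto_of_le_of_le' tendsto_const_nhds hlim
    (Eventually.of_forall fun _ => zero_le) ?_
  filter_upwards [eventually_ceil_lt hr hc0] with n hkn
  rw [← mul_assoc (Real.exp _)]
  exact pointsMeasure_chainLenSingle_lt_le hr (Nat.sub_add_cancel hkn.le).symm
    (Nat.sub_pos_of_lt hkn) ht.le

theorem ae_pointsMeasure_one_chainLenSingle_eq (n : ℕ) :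
    ∀ᵐ ω ∂pointsMeasure 1 n, chainLenSingle ω = n := by
  filter_upwards [ae_pointsMeasure_injective 1 n, ae_pointsMeasure_mem_above_zero 1 n] with ω hω h0
  refine (chainLenSingle_le ω).antisymm (le_chainLenSingle_of_hasIndexChain hω
    ⟨Finset.univ, by simp, fun i _ => h0 i, fun i _ j _ _ => ?_⟩)
  simp only [leSingleBlock, Fin.forall_fin_one]
  exact le_total _ _

end Convergence

/-- **Proposition 5.4(1).** Fix `r ≥ 1` and let `A` be the partition of
`{1,…,r}` consisting of the single part `{1,…,r}`. For `S_n` a set of `n`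
independent uniformly random points in `[0,1]^r`, `L_A(S_n)/n^(1/r)`
converges in probability to `r/Γ(1/r)`. -/
theorem random_points_single_block_limit (r : ℕ) (hr : 1 ≤ r) :
    ∀ ε : ℝ, 0 < ε →
      Filter.Tendsto
        (fun n : ℕ => pointsMeasure r n
          {ω | ε ≤ |(chainLenSingle ω : ℝ) / (n : ℝ) ^ ((1 : ℝ) / (r : ℝ))
            - (r : ℝ) / Real.Gamma (1 / (r : ℝ))|})
        Filter.atTop (nhds 0) := by
  intro ε hε
  obtain rfl | hr2 : r = 1 ∨ 2 ≤ r := by omega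
  · refine tendsto_const_nhds.congr' ?_
    filter_upwards [Filter.eventually_gt_atTop 0] with n hn
    refine (measure_eq_zero_iff_ae_notMem.2 ?_).symm
    filter_upwards [ae_pointsMeasure_one_chainLenSingle_eq n] with ω hω h
    have hn' : (n : ℝ) ≠ 0 := by exact_mod_cast hn.ne'
    simp only [hω, Nat.cast_one, div_one, Real.rpow_one, Real.Gamma_one,
      div_self hn', sub_self, abs_zero] at h
    exact h.not_gt hε
  · have hr0 : (0 : ℝ) < r := by exact_mod_cast hr
    have hΓ : 0 < Real.Gamma (1 / (r : ℝ)) := Real.Gamma_pos_of_pos (by positivity)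
    set b : ℝ := (r : ℝ) / Real.Gamma (1 / (r : ℝ)) with hb
    have hb0 : 0 < b := div_pos hr0 hΓ
    have hw : Real.Gamma (1 / (r : ℝ)) / r = b⁻¹ := (inv_div _ _).symm
    have hlow : b - ε / 2 ≤ max (b - ε / 2) (b / 2) := le_max_left _ _
    have hupper := tendsto_pointsMeasure_le_chainLenSingle hr2 (c := b + ε) (by
      rw [hw, ← div_eq_mul_inv, one_lt_div hb0]
      linarith)
    have hlower := tendsto_pointsMeasure_chainLenSingle_lt hr2 (c := max (b - ε / 2) (b / 2))
      (lt_max_of_lt_right (by linarith)) (by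
        rw [hw, ← div_eq_mul_inv, div_lt_one hb0]
        exact max_lt (by linarith) (by linarith))
    have hsum := hupper.add hlower
    rw [add_zero] at hsum
    refine tendsto_of_tendsto_of_tendsto_of_le_of_le' tendsto_const_nhds hsum
      (Filter.Eventually.of_forall fun _ => zero_le) ?_
    filter_upwards [Filter.eventually_gt_atTop 0] with n hn
    refine (measure_mono fun ω hω => ?_).trans (measure_union_le _ _)
    have hs : 0 < (n : ℝ) ^ ((1 : ℝ) / (r : ℝ)) := Real.rpow_pos_of_pos (by exact_mod_cast hn) _
    rcases le_abs.1 (show ε ≤ |_| from hω) with h | h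
    · refine .inl (Nat.ceil_le.2 ?_)
      rw [← le_div_iff₀ hs]
      linarith
    · refine .inr (Nat.lt_ceil.2 ?_)
      rw [← div_lt_iff₀ hs]
      linarith
end

section
/- Let r ≥ 2 and let Q be an ordered r-matching with at least two edges. Suppose there exist n_Q > 0 and α > 0 such that ex_<(n', Q) ≤ α·(n')^{r−1} for all n' ≥ n_Q. Then, for all n sufficiently large in terms of r and n_Q, the number of Q-free ordered r-matchings of size n (i.e., ordered r-matchings on {1,…,rn} containing no sub-matching order-isomorphic to Q) is at most e^{40n}·(α·r^r·n^{r−2})^{(r/(r−1))n}. -/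
/-- An ordered `r`-matching of size `n`: a partition of `{1,…,r*n}` into `n`
edges, each of size `r`. -/
def IsOrderedMatching (r n : ℕ) (M : Finset (Finset ℕ)) : Prop :=
  M.card = n ∧ (∀ e ∈ M, e.card = r) ∧
    (∀ e ∈ M, ∀ f ∈ M, e ≠ f → Disjoint e f) ∧
    M.biUnion id = Finset.Icc 1 (r * n)

/-- Two edges `e, f` form the pattern `P`: there is a strictly increasing map
on `e ∪ f` sending the pair `{e, f}` to the pair of edges of `P`. -/
def FormsPattern (e f : Finset ℕ) (P : Finset (Finset ℕ)) : Prop :=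
  ∃ φ : ℕ → ℕ, StrictMonoOn φ (↑(e ∪ f) : Set ℕ) ∧
    ({e.image φ, f.image φ} : Finset (Finset ℕ)) = P

/-- An `r`-pattern: an ordered `r`-matching of size `2` (on `{1,…,2r}`). -/
def IsPattern (r : ℕ) (P : Finset (Finset ℕ)) : Prop :=
  IsOrderedMatching r 2 P

/-- A collection of edges in which every pair of distinct edges forms `P`. -/
def IsPatternClique (P S : Finset (Finset ℕ)) : Prop :=
  ∀ e ∈ S, ∀ f ∈ S, e ≠ f → FormsPattern e f P

/-- `L_P(M)`: the maximum size of a sub-matching of `M` which is a `P`-clique. -/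
noncomputable def cliqueSize (P M : Finset (Finset ℕ)) : ℕ :=
  sSup {k | ∃ S ⊆ M, IsPatternClique P S ∧ S.card = k}

/-- `L(M) = max_P L_P(M)`, the maximum over all `r`-patterns `P`. -/
noncomputable def Lmax (r : ℕ) (M : Finset (Finset ℕ)) : ℕ :=
  sSup {k | ∃ P, IsPattern r P ∧ cliqueSize P M = k}

/-- An ordered `r`-graph on the vertex set `{1,…,n}`: every edge has `r`
vertices, drawn from `{1,…,n}`. -/
def IsOrderedGraph (r n : ℕ) (G : Finset (Finset ℕ)) : Prop :=
  ∀ e ∈ G, e.card = r ∧ e ⊆ Finset.Icc 1 n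

/-- `G` contains a subgraph order-isomorphic to `F`: there is a strictly
increasing map on the vertices of `F` sending every edge of `F` to an edge
of `G`. -/
def ContainsCopy (G F : Finset (Finset ℕ)) : Prop :=
  ∃ φ : ℕ → ℕ, StrictMonoOn φ (↑(F.biUnion id) : Set ℕ) ∧ ∀ e ∈ F, e.image φ ∈ G

/-- `ex_<(n, F)`: the maximum number of edges in an `F`-free ordered `r`-graph
on `n` vertices. -/
noncomputable def exOrd (r n : ℕ) (F : Finset (Finset ℕ)) : ℕ :=
  sSup {k | ∃ G, IsOrderedGraph r n G ∧ ¬ ContainsCopy G F ∧ G.card = k}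

/-- The number of `Q`-free ordered `r`-matchings of size `n`: ordered
`r`-matchings on `{1,…,r*n}` containing no sub-matching order-isomorphic
to `Q`. -/
noncomputable def qFreeMatchingCount (r n : ℕ) (Q : Finset (Finset ℕ)) : ℕ :=
  Nat.card {M : Finset (Finset ℕ) // IsOrderedMatching r n M ∧ ¬ ContainsCopy M Q}

/-- The vertex set of an edge listed as a tuple. -/
def tupleEdge {r : ℕ} (f : Fin r → ℕ) : Finset ℕ := Finset.univ.image f

open scoped Classical in
/-- The weakly increasing `r`-tuples with entries in `{1,…,m}`. -/
noncomputable def monoTuples (r m : ℕ) : Finset (Fin r → ℕ) :=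
  (Fintype.piFinset fun _ => Finset.Icc 1 m).filter Monotone

open scoped Classical in
/-- The ordered `r`-graph formed by the strictly increasing members of a family of tuples. -/
noncomputable def strictEdges {r : ℕ} (F : Finset (Fin r → ℕ)) : Finset (Finset ℕ) :=
  (F.filter StrictMono).image tupleEdge

open scoped Classical in
/-- Families of weakly increasing `r`-tuples over `{1,…,m}` whose strictly increasing members
form a `Q`-free ordered `r`-graph. -/
noncomputable def freeSystems (r m : ℕ) (Q : Finset (Finset ℕ)) :
    Finset (Finset (Fin r → ℕ)) :=
  (monoTuples r m).powerset.filter fun F => ¬ ContainsCopy (strictEdges F) Q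

/-- The map contracting consecutive blocks of `s` positive integers to single points. -/
def blockMap (s x : ℕ) : ℕ := (x + s - 1) / s

theorem mem_monoTuples {r m : ℕ} {f : Fin r → ℕ} :
    f ∈ monoTuples r m ↔ (∀ i, 1 ≤ f i ∧ f i ≤ m) ∧ Monotone f := by
  simp [monoTuples]

theorem mem_freeSystems {r m : ℕ} {Q : Finset (Finset ℕ)} {F : Finset (Fin r → ℕ)} :
    F ∈ freeSystems r m Q ↔ F ⊆ monoTuples r m ∧ ¬ ContainsCopy (strictEdges F) Q := by
  simp [freeSystems]

theorem mem_strictEdges {r : ℕ} {F : Finset (Fin r → ℕ)} {e : Finset ℕ} :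
    e ∈ strictEdges F ↔ ∃ f ∈ F, StrictMono f ∧ tupleEdge f = e := by
  simp [strictEdges, and_assoc]

theorem card_tupleEdge {r : ℕ} {f : Fin r → ℕ} (hf : StrictMono f) :
    (tupleEdge f).card = r := by
  simp [tupleEdge, Finset.card_image_of_injective _ hf.injective]

theorem tupleEdge_inj {r : ℕ} {f g : Fin r → ℕ} (hf : StrictMono f) (hg : StrictMono g)
    (h : tupleEdge f = tupleEdge g) : f = g := by
  have h1 : Set.range f = Set.range g := by
    have := congrArg (fun s : Finset ℕ => (s : Set ℕ)) h
    simpa [tupleEdge] using this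
  exact (StrictMono.range_inj hf hg).1 h1

theorem card_strictEdges {r : ℕ} {F : Finset (Fin r → ℕ)} (hF : ∀ f ∈ F, StrictMono f) :
    (strictEdges F).card = F.card := by
  classical
  rw [strictEdges, Finset.filter_true_of_mem hF, Finset.card_image_of_injOn]
  intro f hf g hg h
  exact tupleEdge_inj (hF f hf) (hF g hg) h

theorem blockMap_mono (s : ℕ) : Monotone (blockMap s) := fun _ _ h =>
  Nat.div_le_div_right (by omega)

theorem blockMap_mem {s m m' x : ℕ} (hs : 1 ≤ s) (hm : m' ≤ s * m) (h1 : 1 ≤ x) (h2 : x ≤ m') :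
    1 ≤ blockMap s x ∧ blockMap s x ≤ m := by
  constructor
  · rw [blockMap, Nat.one_le_div_iff (by omega)]; omega
  · rw [blockMap, ← Nat.lt_succ_iff, Nat.div_lt_iff_lt_mul (by omega)]
    have : (m + 1) * s = s * m + s := by ring
    simp only [Nat.succ_eq_add_one]
    omega

theorem blockMap_fiber {s x y : ℕ} (hs : 1 ≤ s) (h : blockMap s x = blockMap s y)
    (h' : (x + s - 1) % s = (y + s - 1) % s) : x = y := by
  have h1 := Nat.div_add_mod (x + s - 1) s
  have h2 := Nat.div_add_mod (y + s - 1) s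
  rw [blockMap, blockMap] at h
  rw [h, h', h2] at h1
  omega

theorem ContainsCopy.of_contract {r q : ℕ} (hr : 0 < r) {Q : Finset (Finset ℕ)}
    (hQ : IsOrderedMatching r q Q)
    {c : ℕ → ℕ} (hc : Monotone c) {F I : Finset (Fin r → ℕ)}
    (hI : ∀ g ∈ I, ∃ f ∈ F, g = c ∘ f) (h : ContainsCopy (strictEdges I) Q) :
    ContainsCopy (strictEdges F) Q := by
  classical
  obtain ⟨φ, hφ, hE⟩ := h
  have key : ∀ e ∈ Q, ∃ ψ : ℕ → ℕ, (∀ v ∈ e, c (ψ v) = φ v) ∧ e.image ψ ∈ strictEdges F := by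
    intro e he
    obtain ⟨g, hg, hgs, hge⟩ := mem_strictEdges.1 (hE e he)
    obtain ⟨f, hf, rfl⟩ := hI g hg
    have hfs : StrictMono f := fun i j hij => by
      by_contra hlt
      exact absurd (hgs hij) (not_lt.2 (hc (not_lt.1 hlt)))
    have hex : ∀ v, ∃ i : Fin r, v ∈ e → c (f i) = φ v := by
      intro v
      by_cases hv : v ∈ e
      · have : φ v ∈ tupleEdge (c ∘ f) := hge ▸ Finset.mem_image_of_mem φ hv
        obtain ⟨i, -, hi⟩ := Finset.mem_image.1 this
        exact ⟨i, fun _ => hi⟩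
      · exact ⟨⟨0, hr⟩, fun h => absurd h hv⟩
    choose ι hι using hex
    refine ⟨fun v => f (ι v), hι, mem_strictEdges.2 ⟨f, hf, hfs, ?_⟩⟩
    ext x
    simp only [tupleEdge, Finset.mem_image, Finset.mem_univ, true_and]
    constructor
    · rintro ⟨i, rfl⟩
      have : (c ∘ f) i ∈ e.image φ := hge ▸ Finset.mem_image_of_mem _ (Finset.mem_univ i)
      obtain ⟨v, hv, hvi⟩ := Finset.mem_image.1 this
      refine ⟨v, hv, congrArg f (hgs.injective ?_)⟩
      rw [← hvi]
      exact hι v hv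
    · rintro ⟨v, -, rfl⟩
      exact ⟨_, rfl⟩
  choose! ψ hψ hψF using key
  have hedge : ∀ v, ∃ e, v ∈ Q.biUnion id → e ∈ Q ∧ v ∈ e := by
    intro v
    by_cases hv : v ∈ Q.biUnion id
    · obtain ⟨e, he, hve⟩ := Finset.mem_biUnion.1 hv
      exact ⟨e, fun _ => ⟨he, hve⟩⟩
    · exact ⟨∅, fun h => absurd h hv⟩
  choose E hEd using hedge
  refine ⟨fun v => ψ (E v) v, ?_, ?_⟩
  · intro v hv w hw hvw
    obtain ⟨h1, h2⟩ := hEd v hv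
    obtain ⟨h3, h4⟩ := hEd w hw
    have h5 := hφ hv hw hvw
    rw [← hψ _ h1 v h2, ← hψ _ h3 w h4] at h5
    by_contra hlt
    exact absurd h5 (not_lt.2 (hc (not_lt.1 hlt)))
  · intro e he
    convert hψF e he using 1
    refine Finset.image_congr fun v hv => ?_
    obtain ⟨h1, h2⟩ := hEd v (Finset.mem_biUnion.2 ⟨e, he, hv⟩)
    have : E v = e := by
      by_contra hne
      exact Finset.disjoint_left.1 (hQ.2.2.1 _ h1 _ he hne) h2 hv
    simp only [this]

theorem card_le_exOrd {r n : ℕ} {Q G : Finset (Finset ℕ)} (hG : IsOrderedGraph r n G)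
    (hGQ : ¬ ContainsCopy G Q) : G.card ≤ exOrd r n Q := by
  refine le_csSup ⟨((Finset.Icc 1 n).powerset).card, ?_⟩ ⟨G, hG, hGQ, rfl⟩
  rintro _ ⟨G', hG', -, rfl⟩
  exact Finset.card_le_card fun e he => Finset.mem_powerset.2 (hG' e he).2

theorem isOrderedGraph_strictEdges {r m : ℕ} {F : Finset (Fin r → ℕ)} (hF : F ⊆ monoTuples r m) :
    IsOrderedGraph r m (strictEdges F) := by
  intro e he
  obtain ⟨f, hf, hfs, rfl⟩ := mem_strictEdges.1 he
  refine ⟨card_tupleEdge hfs, fun x hx => ?_⟩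
  obtain ⟨i, -, rfl⟩ := Finset.mem_image.1 hx
  exact Finset.mem_Icc.2 ((mem_monoTuples.1 (hF hf)).1 i)

theorem not_containsCopy_of_common_vertex {r q a : ℕ} {Q G : Finset (Finset ℕ)} (hq : 2 ≤ q)
    (hQ : IsOrderedMatching r q Q) (hG : ∀ e ∈ G, a ∈ e) : ¬ ContainsCopy G Q := by
  rintro ⟨φ, hφ, hE⟩
  obtain ⟨e, he, f, hf, hef⟩ := Finset.one_lt_card.1 (show 1 < Q.card by rw [hQ.1]; omega)
  obtain ⟨v, hv, hva⟩ := Finset.mem_image.1 (hG _ (hE e he))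
  obtain ⟨w, hw, hwa⟩ := Finset.mem_image.1 (hG _ (hE f hf))
  have hvw : v = w := hφ.injOn (Finset.mem_biUnion.2 ⟨e, he, hv⟩)
    (Finset.mem_biUnion.2 ⟨f, hf, hw⟩) (hva.trans hwa.symm)
  exact Finset.disjoint_left.1 (hQ.2.2.1 e he f hf hef) hv (hvw ▸ hw)

/-- Prepending the vertex `1` turns weakly increasing `k`-tuples into edges of a star. -/
def starTuple {k : ℕ} (g : Fin k → ℕ) : Fin (k + 1) → ℕ :=
  Fin.cons 1 fun j => g j + j + 1

theorem card_monoTuples_le_exOrd {k q m : ℕ} {Q : Finset (Finset ℕ)} (hk : 0 < k)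
    (hq : 2 ≤ q) (hQ : IsOrderedMatching (k + 1) q Q) :
    (monoTuples k m).card ≤ exOrd (k + 1) (m + k) Q := by
  classical
  have hst : ∀ g ∈ monoTuples k m, StrictMono (starTuple g) := by
    intro g hg
    obtain ⟨h1, h2⟩ := mem_monoTuples.1 hg
    intro i j hij
    induction j using Fin.cases with
    | zero => exact absurd hij (Fin.not_lt_zero _)
    | succ j =>
      induction i using Fin.cases with
      | zero =>
        have := (h1 j).1
        simp only [starTuple, Fin.cons_zero, Fin.cons_succ]
        omega
      | succ i =>
        have hij' : i < j := Fin.succ_lt_succ_iff.1 hij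
        have := h2 hij'.le
        have : (i : ℕ) < j := hij'
        simp only [starTuple, Fin.cons_succ]
        omega
  have hinj : Function.Injective (starTuple (k := k)) := by
    intro g g' h
    funext j
    have := congrFun h j.succ
    simpa [starTuple] using this
  have hstrict : ∀ f ∈ (monoTuples k m).image starTuple, StrictMono f := by
    intro f hf
    obtain ⟨g, hg, rfl⟩ := Finset.mem_image.1 hf
    exact hst g hg
  rw [← Finset.card_image_of_injective _ hinj, ← card_strictEdges hstrict]
  refine card_le_exOrd (isOrderedGraph_strictEdges fun f hf => ?_)
    (not_containsCopy_of_common_vertex (a := 1) hq hQ fun e he => ?_)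
  · obtain ⟨g, hg, rfl⟩ := Finset.mem_image.1 hf
    refine mem_monoTuples.2 ⟨fun i => ?_, (hst g hg).monotone⟩
    induction i using Fin.cases with
    | zero =>
      have := (mem_monoTuples.1 hg).1 ⟨0, hk⟩
      simp only [starTuple, Fin.cons_zero]
      omega
    | succ i =>
      have := (mem_monoTuples.1 hg).1 i
      have := i.isLt
      simp only [starTuple, Fin.cons_succ]
      omega
  · obtain ⟨f, hf, -, rfl⟩ := mem_strictEdges.1 he
    obtain ⟨g, -, rfl⟩ := Finset.mem_image.1 hf
    exact Finset.mem_image.2 ⟨0, Finset.mem_univ _, rfl⟩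

theorem card_filter_not_strictMono_le (k m : ℕ) {F : Finset (Fin (k + 1) → ℕ)}
    (hF : F ⊆ monoTuples (k + 1) m) :
    (F.filter fun f => ¬ StrictMono f).card ≤ k * (monoTuples k m).card := by
  classical
  have hcard : (Finset.univ ×ˢ monoTuples k m : Finset (Fin k × (Fin k → ℕ))).card
      = k * (monoTuples k m).card := by simp
  rw [← hcard]
  refine Finset.card_le_card_of_surjOn (fun p => p.2 ∘ p.1.predAbove) ?_
  intro f hf
  obtain ⟨hfF, hns⟩ := Finset.mem_filter.1 (Finset.mem_coe.1 hf)
  obtain ⟨h1, h2⟩ := mem_monoTuples.1 (hF hfF)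
  have hex : ∃ i : Fin k, f i.castSucc = f i.succ := by
    by_contra! hne
    refine hns (Fin.strictMono_iff_lt_succ.2 fun i => ?_)
    exact lt_of_le_of_ne (h2 i.castSucc_lt_succ.le) (hne i)
  obtain ⟨i, hi⟩ := hex
  refine ⟨(i, f ∘ i.succ.succAbove), ?_, ?_⟩
  · simp only [Finset.coe_product, Set.mem_prod, Finset.mem_coe, Finset.mem_univ, true_and]
    exact mem_monoTuples.2
      ⟨fun j => h1 _, h2.comp (Fin.strictMono_succAbove _).monotone⟩
  · funext j
    simp only [Function.comp_apply]
    rcases le_or_gt j i.castSucc with hj | hj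
    · rw [Fin.predAbove_of_le_castSucc _ _ hj, Fin.succAbove_of_castSucc_lt, Fin.castSucc_castPred]
      rw [Fin.castSucc_castPred]
      exact hj.trans_lt i.castSucc_lt_succ
    · rw [Fin.predAbove_of_castSucc_lt _ _ hj]
      rcases (Fin.castSucc_lt_iff_succ_le.1 hj).eq_or_lt with h | h
      · subst h
        rw [Fin.pred_succ, Fin.succAbove_succ_self, hi]
      · rw [Fin.succAbove_of_le_castSucc, Fin.succ_pred]
        rw [Fin.le_def]
        rw [Fin.lt_def] at h
        simp only [Fin.val_castSucc, Fin.val_pred, Fin.val_succ] at h ⊢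
        omega

theorem pow_le_factorial_mul_card_monoTuples (k m : ℕ) :
    m ^ k ≤ k.factorial * (monoTuples k m).card := by
  classical
  have h1 : (Fintype.piFinset fun _ : Fin k => Finset.Icc 1 m).card = m ^ k := by simp
  have h2 : (Finset.univ ×ˢ monoTuples k m :
      Finset (Equiv.Perm (Fin k) × (Fin k → ℕ))).card
      = k.factorial * (monoTuples k m).card := by simp [Fintype.card_perm]
  rw [← h1, ← h2]
  refine Finset.card_le_card_of_surjOn (fun p => p.2 ∘ p.1) ?_
  intro f hf
  have hf' : ∀ i, 1 ≤ f i ∧ f i ≤ m := fun i => Finset.mem_Icc.1 (Fintype.mem_piFinset.1 hf i)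
  refine ⟨((Tuple.sort f)⁻¹, f ∘ Tuple.sort f), ?_, ?_⟩
  · simp only [Finset.coe_product, Set.mem_prod, Finset.mem_coe, Finset.mem_univ, true_and]
    exact mem_monoTuples.2 ⟨fun i => hf' _, Tuple.monotone_sort f⟩
  · funext i
    simp

theorem card_le_of_mem_freeSystems {k q m : ℕ} {Q : Finset (Finset ℕ)} (hk : 0 < k)
    (hq : 2 ≤ q) (hQ : IsOrderedMatching (k + 1) q Q) {F : Finset (Fin (k + 1) → ℕ)}
    (hF : F ∈ freeSystems (k + 1) m Q) :
    F.card ≤ exOrd (k + 1) m Q + k * exOrd (k + 1) (m + k) Q := by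
  classical
  obtain ⟨h1, h2⟩ := mem_freeSystems.1 hF
  rw [← Finset.card_filter_add_card_filter_not (s := F) (fun f => StrictMono f)]
  refine add_le_add ?_ ((card_filter_not_strictMono_le k m h1).trans
    (Nat.mul_le_mul_left _ (card_monoTuples_le_exOrd hk hq hQ)))
  have : (strictEdges F).card = (F.filter StrictMono).card :=
    Finset.card_image_of_injOn fun f hf g hg h =>
      tupleEdge_inj (Finset.mem_filter.1 hf).2 (Finset.mem_filter.1 hg).2 h
  rw [← this]
  exact card_le_exOrd (isOrderedGraph_strictEdges h1) h2

open scoped Classical in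
/-- The tuples over `{1,…,m'}` whose contraction by blocks of length `s` lies in `I`. -/
noncomputable def blockFiber {r : ℕ} (m' s : ℕ) (I : Finset (Fin r → ℕ)) :
    Finset (Fin r → ℕ) :=
  (monoTuples r m').filter fun f => blockMap s ∘ f ∈ I

theorem card_blockFiber_le {r m' s : ℕ} (hs : 1 ≤ s) (I : Finset (Fin r → ℕ)) :
    (blockFiber m' s I).card ≤ s ^ r * I.card := by
  classical
  have hc : ((Fintype.piFinset fun _ : Fin r => Finset.range s) ×ˢ I).card
      = s ^ r * I.card := by simp
  rw [← hc]
  refine Finset.card_le_card_of_injOn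
    (fun f => ((fun i => (f i + s - 1) % s), blockMap s ∘ f)) ?_ ?_
  · intro f hf
    refine Finset.mem_coe.2 (Finset.mem_product.2
      ⟨Fintype.mem_piFinset.2 fun i => Finset.mem_range.2 (Nat.mod_lt _ hs), ?_⟩)
    exact (Finset.mem_filter.1 hf).2
  · intro f _ g _ h
    obtain ⟨h1, h2⟩ := Prod.mk.inj h
    funext i
    exact blockMap_fiber hs (congrFun h2 i) (congrFun h1 i)

theorem image_blockMap_mem_freeSystems {r q m m' s : ℕ} (hr : 0 < r)
    {Q : Finset (Finset ℕ)} (hQ : IsOrderedMatching r q Q) (hs : 1 ≤ s) (hm : m' ≤ s * m)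
    {F : Finset (Fin r → ℕ)} (hF : F ∈ freeSystems r m' Q) :
    F.image (blockMap s ∘ ·) ∈ freeSystems r m Q := by
  obtain ⟨h1, h2⟩ := mem_freeSystems.1 hF
  refine mem_freeSystems.2 ⟨fun g hg => ?_, fun h => h2 ?_⟩
  · obtain ⟨f, hf, rfl⟩ := Finset.mem_image.1 hg
    obtain ⟨h3, h4⟩ := mem_monoTuples.1 (h1 hf)
    exact mem_monoTuples.2
      ⟨fun i => blockMap_mem hs hm (h3 i).1 (h3 i).2, (blockMap_mono s).comp h4⟩
  · refine h.of_contract hr hQ (blockMap_mono s) fun g hg => ?_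
    obtain ⟨f, hf, rfl⟩ := Finset.mem_image.1 hg
    exact ⟨f, hf, rfl⟩

theorem subset_blockFiber_image {r m' s : ℕ} {F : Finset (Fin r → ℕ)}
    (hF : F ⊆ monoTuples r m') : F ⊆ blockFiber m' s (F.image (blockMap s ∘ ·)) := fun _ hf =>
  Finset.mem_filter.2 ⟨hF hf, Finset.mem_image_of_mem _ hf⟩

theorem card_freeSystems_le {r q m m' s b : ℕ} (hr : 0 < r) {Q : Finset (Finset ℕ)}
    (hQ : IsOrderedMatching r q Q) (hs : 1 ≤ s) (hm : m' ≤ s * m)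
    (hb : ∀ I ∈ freeSystems r m Q, I.card ≤ b) :
    (freeSystems r m' Q).card ≤ (freeSystems r m Q).card * 2 ^ (s ^ r * b) := by
  classical
  have hsub : freeSystems r m' Q ⊆
      (freeSystems r m Q).biUnion fun I => (blockFiber m' s I).powerset := fun F hF =>
    Finset.mem_biUnion.2 ⟨_, image_blockMap_mem_freeSystems hr hQ hs hm hF,
      Finset.mem_powerset.2 (subset_blockFiber_image (mem_freeSystems.1 hF).1)⟩
  refine (Finset.card_le_card hsub).trans (Finset.card_biUnion_le_card_mul _ _ _ fun I hI => ?_)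
  rw [Finset.card_powerset]
  exact Nat.pow_le_pow_right (by norm_num) ((card_blockFiber_le hs I).trans
    (Nat.mul_le_mul_left _ (hb I hI)))

theorem card_freeSystems_card_eq_le {r q m m' s b n : ℕ} (hr : 0 < r) {Q : Finset (Finset ℕ)}
    (hQ : IsOrderedMatching r q Q) (hs : 1 ≤ s) (hm : m' ≤ s * m)
    (hb : ∀ I ∈ freeSystems r m Q, I.card ≤ b) :
    ((freeSystems r m' Q).filter fun F => F.card = n).card ≤
      (freeSystems r m Q).card * (s ^ r * b).choose n := by
  classical
  have hsub : ((freeSystems r m' Q).filter fun F => F.card = n) ⊆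
      (freeSystems r m Q).biUnion fun I => (blockFiber m' s I).powersetCard n := by
    intro F hF
    obtain ⟨hF, hn⟩ := Finset.mem_filter.1 hF
    exact Finset.mem_biUnion.2 ⟨_, image_blockMap_mem_freeSystems hr hQ hs hm hF,
      Finset.mem_powersetCard.2 ⟨subset_blockFiber_image (mem_freeSystems.1 hF).1, hn⟩⟩
  refine (Finset.card_le_card hsub).trans (Finset.card_biUnion_le_card_mul _ _ _ fun I hI => ?_)
  rw [Finset.card_powersetCard]
  exact Nat.choose_le_choose _ ((card_blockFiber_le hs I).trans
    (Nat.mul_le_mul_left _ (hb I hI)))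

theorem card_monoTuples_le (r m : ℕ) : (monoTuples r m).card ≤ m ^ r := by
  classical
  refine (Finset.card_filter_le _ _).trans ?_
  simp

theorem card_freeSystems_le_two_pow (r m : ℕ) (Q : Finset (Finset ℕ)) :
    (freeSystems r m Q).card ≤ 2 ^ m ^ r := by
  classical
  refine (Finset.card_filter_le _ _).trans ?_
  rw [Finset.card_powerset]
  exact Nat.pow_le_pow_right (by norm_num) (card_monoTuples_le r m)

open scoped Classical in
/-- The edges of a matching on `{1,…,r*n}`, listed in increasing order. -/
noncomputable def matchingTuples (r n : ℕ) (M : Finset (Finset ℕ)) : Finset (Fin r → ℕ) :=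
  (monoTuples r (r * n)).filter fun f => StrictMono f ∧ tupleEdge f ∈ M

theorem strictEdges_matchingTuples {r n : ℕ} {M : Finset (Finset ℕ)}
    (hM : IsOrderedMatching r n M) : strictEdges (matchingTuples r n M) = M := by
  ext e
  rw [mem_strictEdges]
  constructor
  · rintro ⟨f, hf, -, rfl⟩
    exact (Finset.mem_filter.1 hf).2.2
  · intro he
    have hcard := hM.2.1 e he
    have hmem : ∀ i, e.orderEmbOfFin hcard i ∈ Finset.Icc 1 (r * n) := fun i => by
      rw [← hM.2.2.2]
      exact Finset.mem_biUnion.2 ⟨e, he, Finset.orderEmbOfFin_mem e hcard i⟩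
    have hedge : tupleEdge (e.orderEmbOfFin hcard) = e := by
      rw [← Finset.coe_inj]
      simp [tupleEdge]
    refine ⟨e.orderEmbOfFin hcard, Finset.mem_filter.2
      ⟨mem_monoTuples.2 ⟨fun i => Finset.mem_Icc.1 (hmem i),
        (e.orderEmbOfFin hcard).monotone⟩, (e.orderEmbOfFin hcard).strictMono, ?_⟩,
      (e.orderEmbOfFin hcard).strictMono, hedge⟩
    rw [hedge]
    exact he

theorem qFreeMatchingCount_le (r n : ℕ) (Q : Finset (Finset ℕ)) :
    qFreeMatchingCount r n Q ≤
      ((freeSystems r (r * n) Q).filter fun F => F.card = n).card := by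
  classical
  rw [← Nat.card_eq_finsetCard, qFreeMatchingCount]
  refine Nat.card_le_card_of_injective (fun M => ⟨matchingTuples r n M.1, ?_⟩) ?_
  · obtain ⟨M, hM, hMQ⟩ := M
    have hstrict : ∀ f ∈ matchingTuples r n M, StrictMono f := fun f hf =>
      (Finset.mem_filter.1 hf).2.1
    refine Finset.mem_filter.2 ⟨mem_freeSystems.2 ⟨Finset.filter_subset _ _, ?_⟩, ?_⟩
    · rwa [strictEdges_matchingTuples hM]
    · rw [← card_strictEdges hstrict, strictEdges_matchingTuples hM, hM.1]
  · intro M M' h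
    have h' := congrArg strictEdges (Subtype.mk.inj h)
    rw [strictEdges_matchingTuples M.2.1, strictEdges_matchingTuples M'.2.1] at h'
    exact Subtype.ext h'

theorem card_freeSystems_card_eq_le_choose (r m n : ℕ) (Q : Finset (Finset ℕ)) :
    ((freeSystems r m Q).filter fun F => F.card = n).card ≤ (m ^ r).choose n := by
  classical
  have hsub : ((freeSystems r m Q).filter fun F => F.card = n) ⊆
      (monoTuples r m).powersetCard n := fun F hF =>
    Finset.mem_powersetCard.2 ⟨(mem_freeSystems.1 (Finset.mem_filter.1 hF).1).1,
      (Finset.mem_filter.1 hF).2⟩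
  refine (Finset.card_le_card hsub).trans ?_
  rw [Finset.card_powersetCard]
  exact Nat.choose_le_choose _ (card_monoTuples_le r m)

theorem add_pow_le_exp_mul_pow {x a : ℝ} (hx : 0 < x) (ha : 0 ≤ a) (j : ℕ) :
    (x + a) ^ j ≤ Real.exp (j * (a / x)) * x ^ j := by
  have h1 : x + a ≤ Real.exp (a / x) * x := by
    have := mul_le_mul_of_nonneg_right (Real.add_one_le_exp (a / x)) hx.le
    rwa [add_mul, div_mul_cancel₀ _ hx.ne', one_mul, add_comm] at this
  calc (x + a) ^ j ≤ (Real.exp (a / x) * x) ^ j := pow_le_pow_left₀ (by positivity) h1 j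
    _ = _ := by rw [mul_pow, ← Real.exp_nat_mul]

theorem add_pow_le_three_mul_pow {k m : ℕ} (hm : (k + 1) ^ 2 ≤ m) :
    ((m : ℝ) + k) ^ k ≤ 3 * (m : ℝ) ^ k := by
  have hm' : ((k : ℝ) + 1) ^ 2 ≤ m := by exact_mod_cast hm
  have hk : (0 : ℝ) ≤ k := by positivity
  have hm0 : (0 : ℝ) < m := by nlinarith
  refine (add_pow_le_exp_mul_pow hm0 hk k).trans ?_
  have h1 : (k : ℝ) * (k / m) ≤ 1 := by
    rw [← mul_div_assoc, div_le_one hm0]; nlinarith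
  have h2 := Real.exp_le_exp.2 h1
  have := Real.exp_one_lt_d9
  gcongr
  linarith

theorem card_le_of_exOrd_le {k q m nQ : ℕ} {Q : Finset (Finset ℕ)} {α : ℝ} (hk : 0 < k)
    (hq : 2 ≤ q) (hQ : IsOrderedMatching (k + 1) q Q) (hα : 0 < α)
    (hex : ∀ m : ℕ, nQ ≤ m → (exOrd (k + 1) m Q : ℝ) ≤ α * (m : ℝ) ^ k)
    (hm : nQ ≤ m) (hmk : (k + 1) ^ 2 ≤ m) {F : Finset (Fin (k + 1) → ℕ)}
    (hF : F ∈ freeSystems (k + 1) m Q) :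
    (F.card : ℝ) ≤ 3 * (k + 1) * α * (m : ℝ) ^ k := by
  have h1 : (F.card : ℝ) ≤ exOrd (k + 1) m Q + k * exOrd (k + 1) (m + k) Q := by
    exact_mod_cast card_le_of_mem_freeSystems hk hq hQ hF
  have h2 := hex m hm
  have h3 := hex (m + k) (by omega)
  push_cast at h3
  have h4 := add_pow_le_three_mul_pow hmk
  have hk0 : (0 : ℝ) ≤ k := by positivity
  have h5 : (k : ℝ) * exOrd (k + 1) (m + k) Q ≤ k * (α * (3 * (m : ℝ) ^ k)) := by
    gcongr
    exact h3.trans (by gcongr)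
  have h6 : 0 ≤ α * (m : ℝ) ^ k := by positivity
  nlinarith

theorem one_le_factorial_mul {k q nQ : ℕ} {Q : Finset (Finset ℕ)} {α : ℝ} (hk : 0 < k)
    (hq : 2 ≤ q) (hQ : IsOrderedMatching (k + 1) q Q) (hα : 0 < α)
    (hex : ∀ m : ℕ, nQ ≤ m → (exOrd (k + 1) m Q : ℝ) ≤ α * (m : ℝ) ^ k) :
    1 ≤ 3 * (k.factorial : ℝ) * α := by
  set m := nQ + (k + 1) ^ 2 with hm
  have h1 : (m : ℝ) ^ k ≤ k.factorial * exOrd (k + 1) (m + k) Q := by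
    exact_mod_cast (pow_le_factorial_mul_card_monoTuples k m).trans
      (Nat.mul_le_mul_left _ (card_monoTuples_le_exOrd hk hq hQ))
  have h3 := hex (m + k) (by omega)
  push_cast at h3
  have h4 := add_pow_le_three_mul_pow (k := k) (m := m) (by omega)
  have hm0 : 0 < m := by positivity
  have hmk : (0 : ℝ) < (m : ℝ) ^ k := by positivity
  have h5 : (m : ℝ) ^ k ≤ k.factorial * (α * (3 * (m : ℝ) ^ k)) :=
    h1.trans (by gcongr; exact h3.trans (by gcongr))
  by_contra! hlt
  nlinarith

theorem half_succ_pow_le {k m : ℕ} (hm : 4 * (k + 1) ≤ m) :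
    (2 : ℝ) ^ k * (((m + 1) / 2 : ℕ) : ℝ) ^ k ≤ 4 / 3 * (m : ℝ) ^ k := by
  have hm' : 4 * ((k : ℝ) + 1) ≤ m := by exact_mod_cast hm
  have hk : (0 : ℝ) ≤ k := by positivity
  have hm0 : (0 : ℝ) < m := by linarith
  have h1 : (2 : ℝ) * (((m + 1) / 2 : ℕ) : ℝ) ≤ m + 1 := by
    exact_mod_cast Nat.mul_div_le (m + 1) 2
  rw [← mul_pow]
  refine (pow_le_pow_left₀ (by positivity) h1 k).trans
    ((add_pow_le_exp_mul_pow hm0 zero_le_one k).trans ?_)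
  gcongr
  have h2 : (k : ℝ) * (1 / m) ≤ 1 / 4 := by
    rw [← mul_div_assoc, mul_one, div_le_iff₀ hm0]; linarith
  have h3 : (3 : ℝ) / 4 ≤ Real.exp (-(k * (1 / m))) := by
    have := Real.add_one_le_exp (-((k : ℝ) * (1 / m)))
    linarith
  rw [Real.exp_neg, ← one_div, le_div_iff₀ (Real.exp_pos _)] at h3
  linarith

theorem card_freeSystems_le_exp {k q K nQ : ℕ} {Q : Finset (Finset ℕ)} {α : ℝ} (hk : 0 < k)
    (hq : 2 ≤ q) (hQ : IsOrderedMatching (k + 1) q Q) (hα : 0 < α)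
    (hex : ∀ m : ℕ, nQ ≤ m → (exOrd (k + 1) m Q : ℝ) ≤ α * (m : ℝ) ^ k)
    (hK : nQ + 4 * (k + 1) ^ 2 ≤ K) (m : ℕ) :
    ((freeSystems (k + 1) m Q).card : ℝ) ≤
      Real.exp ((2 * K : ℕ) ^ (k + 1) + 8 * (3 * (k + 1) * α * (m : ℝ) ^ k)) := by
  have two_pow_le (j : ℕ) : (2 : ℝ) ^ j ≤ Real.exp j := by
    have h : (2 : ℝ) ≤ Real.exp 1 := by have := Real.add_one_le_exp (1 : ℝ); linarith
    rw [← Real.exp_one_pow]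
    gcongr
  induction m using Nat.strong_induction_on with
  | _ m ih =>
    rcases le_or_gt m (2 * K) with hm | hm
    · have h1 : ((freeSystems (k + 1) m Q).card : ℝ) ≤ 2 ^ m ^ (k + 1) := by
        exact_mod_cast card_freeSystems_le_two_pow (k + 1) m Q
      refine h1.trans ((two_pow_le _).trans (Real.exp_le_exp.2 ?_))
      have h2 : ((m ^ (k + 1) : ℕ) : ℝ) ≤ ((2 * K : ℕ) : ℝ) ^ (k + 1) := by
        exact_mod_cast Nat.pow_le_pow_left hm _
      have : 0 ≤ 8 * (3 * (k + 1) * α * (m : ℝ) ^ k) := by positivity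
      linarith
    · have hsq : k + 1 ≤ (k + 1) ^ 2 := Nat.le_self_pow (by norm_num) _
      set m0 := (m + 1) / 2 with hm0
      have hm0K : K ≤ m0 := by omega
      set b := ⌊3 * (k + 1) * α * (m0 : ℝ) ^ k⌋₊ with hb
      have hbr : (b : ℝ) ≤ 3 * (k + 1) * α * (m0 : ℝ) ^ k := Nat.floor_le (by positivity)
      have hrecN : (freeSystems (k + 1) m Q).card ≤
          (freeSystems (k + 1) m0 Q).card * 2 ^ (2 ^ (k + 1) * b) :=
        card_freeSystems_le k.succ_pos hQ one_le_two (by omega) fun I hI =>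
          Nat.le_floor (card_le_of_exOrd_le hk hq hQ hα hex (by omega) (by omega) hI)
      have hrec : ((freeSystems (k + 1) m Q).card : ℝ) ≤
          (freeSystems (k + 1) m0 Q).card * 2 ^ (2 ^ (k + 1) * b) := by
        exact_mod_cast hrecN
      refine hrec.trans ((mul_le_mul (ih m0 (by omega)) (two_pow_le _) (by positivity)
        (Real.exp_pos _).le).trans ?_)
      rw [← Real.exp_add, Real.exp_le_exp]
      have h2 := half_succ_pow_le (k := k) (m := m) (by omega)
      rw [← hm0] at h2
      have h3 : (2 : ℝ) ≤ 2 ^ k := by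
        calc (2 : ℝ) = 2 ^ 1 := by norm_num
          _ ≤ 2 ^ k := pow_le_pow_right₀ one_le_two hk
      have h4 : (m0 : ℝ) ^ k * 2 ≤ 2 ^ k * (m0 : ℝ) ^ k := by
        rw [mul_comm]; gcongr
      have h5 : ((2 ^ (k + 1) * b : ℕ) : ℝ) ≤
          2 ^ (k + 1) * (3 * (k + 1) * α * (m0 : ℝ) ^ k) := by
        push_cast
        gcongr
      have h6 : 8 * (m0 : ℝ) ^ k + 2 ^ (k + 1) * (m0 : ℝ) ^ k ≤ 8 * (m : ℝ) ^ k := by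
        rw [pow_succ]; linarith
      have h7 := mul_le_mul_of_nonneg_left h6 (show 0 ≤ 3 * ((k : ℝ) + 1) * α by positivity)
      linarith

theorem choose_le_exp_mul_pow {N n : ℕ} {x : ℝ} (hx : (N : ℝ) ≤ x * n) :
    (N.choose n : ℝ) ≤ Real.exp n * x ^ n := by
  have h1 := Nat.choose_le_pow_div (α := ℝ) n N
  have h2 := Real.pow_div_factorial_le_exp (n : ℝ) n.cast_nonneg n
  rcases Nat.eq_zero_or_pos n with rfl | hn
  · simp
  have hx0 : 0 ≤ x := by
    by_contra! h
    have : x * n < 0 := mul_neg_of_neg_of_pos h (by positivity)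
    have : (0 : ℝ) ≤ N := N.cast_nonneg
    linarith
  calc (N.choose n : ℝ) ≤ (N : ℝ) ^ n / n.factorial := h1
    _ ≤ (x * n) ^ n / n.factorial := by gcongr
    _ = (n : ℝ) ^ n / n.factorial * x ^ n := by rw [mul_pow]; ring
    _ ≤ _ := by gcongr

theorem qFreeMatchingCount_le_of_pow_le {k q K nQ n : ℕ} {Q : Finset (Finset ℕ)} {α y : ℝ}
    (hk : 0 < k) (hq : 2 ≤ q) (hQ : IsOrderedMatching (k + 1) q Q) (hα : 0 < α)
    (hex : ∀ m : ℕ, nQ ≤ m → (exOrd (k + 1) m Q : ℝ) ≤ α * (m : ℝ) ^ k)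
    (hK : nQ + 4 * (k + 1) ^ 2 ≤ K) (hn : (2 * K) ^ (k + 1) ≤ n) (hy : 0 < y)
    (hyk : y ^ k = 3 * (α * ((k : ℝ) + 1) ^ (k + 1) * (n : ℝ) ^ (k - 1))) :
    (qFreeMatchingCount (k + 1) n Q : ℝ) ≤ Real.exp (12 * n) * y ^ ((k + 1) * n) := by
  have hsq : k + 1 ≤ (k + 1) ^ 2 := Nat.le_self_pow (by norm_num) _
  have hK0 : 0 < K := by omega
  have hKn : K ^ (k + 1) ≤ n := (Nat.pow_le_pow_left (by omega) _).trans hn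
  have hKn1 : K ≤ n := (Nat.le_self_pow (by omega) _).trans hKn
  have hn0 : 0 < n := by omega
  have hnr : (0 : ℝ) < n := by exact_mod_cast hn0
  set r : ℝ := (k : ℝ) + 1 with hr
  have hr0 : 0 < r := by positivity
  set x : ℝ := r * n / y with hx
  have hx0 : 0 < x := by positivity
  have hxy : x * y = r * n := div_mul_cancel₀ _ hy.ne'
  have hnk : (n : ℝ) ^ k = n * (n : ℝ) ^ (k - 1) := by
    rw [← pow_succ', Nat.sub_add_cancel hk]
  have hxk : 3 * r * α * x ^ k = n := by
    have h1 : x ^ k * y ^ k = r ^ k * n ^ k := by rw [← mul_pow, hxy, mul_pow]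
    rw [hyk, hnk, pow_succ] at h1
    have h2 : r ^ k * (n : ℝ) ^ (k - 1) ≠ 0 := by positivity
    apply mul_right_cancel₀ h2
    linarith
  have hcount : (qFreeMatchingCount (k + 1) n Q : ℝ) ≤
      (((freeSystems (k + 1) ((k + 1) * n) Q).filter fun F => F.card = n).card : ℝ) := by
    exact_mod_cast qFreeMatchingCount_le (k + 1) n Q
  refine hcount.trans ?_
  set m := ⌊x⌋₊ with hm
  have hmx : (m : ℝ) ≤ x := Nat.floor_le hx0.le
  have hxm : x < m + 1 := Nat.lt_floor_add_one x
  rw [pow_mul]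
  rcases lt_or_ge m K with hmK | hmK
  · have hxK : x ≤ K := hxm.le.trans (by exact_mod_cast hmK)
    have h1 : ((((k + 1) * n) ^ (k + 1) : ℕ) : ℝ) ≤ y ^ (k + 1) * n := by
      push_cast
      rw [← hr, ← hxy, mul_pow, mul_comm]
      gcongr
      exact (pow_le_pow_left₀ hx0.le hxK _).trans (by exact_mod_cast hKn)
    calc _ ≤ ((((k + 1) * n) ^ (k + 1)).choose n : ℝ) := by
          exact_mod_cast card_freeSystems_card_eq_le_choose (k + 1) ((k + 1) * n) n Q
      _ ≤ Real.exp n * (y ^ (k + 1)) ^ n := choose_le_exp_mul_pow h1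
      _ ≤ _ := by
          gcongr
          linarith
  · have hm0 : (0 : ℝ) < m := by exact_mod_cast hK0.trans_le hmK
    have hrm : r ≤ m := by
      rw [hr]; exact_mod_cast (show k + 1 ≤ m by omega)
    have hβ : 3 * r * α * (m : ℝ) ^ k ≤ n := by
      rw [← hxk]; gcongr
    have hmn : (m : ℝ) ≤ n := by
      refine le_of_pow_le_pow_left₀ hk.ne' hnr.le ?_
      have h1 := one_le_factorial_mul hk hq hQ hα hex
      have h2 : (k.factorial : ℝ) ≤ r * (n : ℝ) ^ (k - 1) := by
        have h3 : (k - 1).factorial ≤ n ^ (k - 1) :=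
          (Nat.factorial_le_pow _).trans (Nat.pow_le_pow_left (by omega) _)
        have h4 : k.factorial ≤ (k + 1) * n ^ (k - 1) := by
          rw [← Nat.mul_factorial_pred hk.ne']
          exact Nat.mul_le_mul (by omega) h3
        rw [hr]; exact_mod_cast h4
      have h5 : 1 ≤ 3 * (r * (n : ℝ) ^ (k - 1)) * α := h1.trans (by gcongr)
      calc (m : ℝ) ^ k ≤ 3 * (r * (n : ℝ) ^ (k - 1)) * α * m ^ k :=
            le_mul_of_one_le_left (by positivity) h5
        _ = 3 * r * α * (m : ℝ) ^ k * n ^ (k - 1) := by ring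
        _ ≤ n * (n : ℝ) ^ (k - 1) := by gcongr
        _ = _ := hnk.symm
    set s := ⌈r * n / m⌉₊ with hs
    have hs1 : 1 ≤ s := Nat.one_le_iff_ne_zero.2 (Nat.ceil_pos.2 (by positivity)).ne'
    have hsm : (k + 1) * n ≤ s * m := by
      have h1 : r * n ≤ s * m := (div_le_iff₀ hm0).1 (Nat.le_ceil _)
      rw [hr] at h1
      exact_mod_cast h1
    have hsr : (s : ℝ) ≤ r * n / m + 1 := (Nat.ceil_lt_add_one (by positivity)).le
    have hspow : (s : ℝ) ^ (k + 1) ≤ Real.exp 2 * y ^ (k + 1) := by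
      have h1 := add_pow_le_exp_mul_pow (show 0 < r * n / m by positivity) zero_le_one (k + 1)
      have h2 := add_pow_le_exp_mul_pow hm0 zero_le_one (k + 1)
      have e1 : ((k + 1 : ℕ) : ℝ) * (1 / (r * n / m)) ≤ 1 := by
        push_cast
        rw [← hr, show r * (1 / (r * n / m)) = m / n by field_simp, div_le_one hnr]
        exact hmn
      have e2 : ((k + 1 : ℕ) : ℝ) * (1 / m) ≤ 1 := by
        push_cast
        rw [← hr, mul_one_div, div_le_one hm0]
        exact hrm
      have h3 : (r * n / m) ^ (k + 1) ≤ Real.exp 1 * y ^ (k + 1) := by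
        rw [← hxy, div_pow, mul_pow, div_le_iff₀ (by positivity)]
        calc x ^ (k + 1) * y ^ (k + 1) ≤ (Real.exp 1 * (m : ℝ) ^ (k + 1)) * y ^ (k + 1) := by
              gcongr
              exact (pow_le_pow_left₀ hx0.le hxm.le _).trans (h2.trans (by gcongr))
          _ = _ := by ring
      calc (s : ℝ) ^ (k + 1) ≤ (r * n / m + 1) ^ (k + 1) := by gcongr
        _ ≤ _ := h1
        _ ≤ Real.exp 1 * (Real.exp 1 * y ^ (k + 1)) := by gcongr
        _ = _ := by rw [← mul_assoc, ← Real.exp_add]; norm_num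
    have hT := card_freeSystems_le_exp hk hq hQ hα hex hK m
    have hmain : (((freeSystems (k + 1) ((k + 1) * n) Q).filter fun F => F.card = n).card : ℝ) ≤
        (freeSystems (k + 1) m Q).card * ((s ^ (k + 1) * n).choose n : ℝ) := by
      have := card_freeSystems_card_eq_le (n := n) (b := n) k.succ_pos hQ hs1 hsm fun I hI => by
        have := card_le_of_exOrd_le hk hq hQ hα hex (by omega) (by omega) hI
        exact_mod_cast this.trans hβ
      exact_mod_cast this
    have hchoose : ((s ^ (k + 1) * n).choose n : ℝ) ≤ Real.exp n * (Real.exp 2 * y ^ (k + 1)) ^ n :=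
      choose_le_exp_mul_pow (by push_cast; gcongr)
    have ha : ((2 * K : ℕ) : ℝ) ^ (k + 1) ≤ n := by exact_mod_cast hn
    calc _ ≤ _ := hmain
      _ ≤ Real.exp (9 * n) * (Real.exp n * (Real.exp 2 * y ^ (k + 1)) ^ n) := by
          gcongr
          refine hT.trans (Real.exp_le_exp.2 ?_)
          rw [← hr]
          linarith
      _ = Real.exp (12 * n) * (y ^ (k + 1)) ^ n := by
          rw [mul_pow, ← Real.exp_nat_mul, ← mul_assoc, ← mul_assoc, ← Real.exp_add,
            ← Real.exp_add]
          ring_nf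

theorem rpow_root_pow_le {k : ℕ} (hk : 0 < k) (n : ℕ) {X : ℝ} (hX : 0 < X) :
    ((3 * X) ^ ((k : ℝ)⁻¹)) ^ ((k + 1) * n) ≤
      Real.exp (4 * n) * X ^ (((k : ℝ) + 1) / k * n) := by
  have hk1 : (1 : ℝ) ≤ k := by exact_mod_cast hk
  have hk0 : (0 : ℝ) < k := by linarith
  rw [← Real.rpow_natCast, ← Real.rpow_mul (by positivity)]
  have h1 : (k : ℝ)⁻¹ * (((k + 1) * n : ℕ) : ℝ) = ((k : ℝ) + 1) / k * n := by
    push_cast; field_simp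
  rw [h1, Real.mul_rpow (by norm_num) hX.le]
  gcongr
  have h2 : ((k : ℝ) + 1) / k ≤ 2 := by rw [div_le_iff₀ hk0]; linarith
  have h3 : (3 : ℝ) ≤ Real.exp 2 := by have := Real.add_one_le_exp (2 : ℝ); linarith
  calc (3 : ℝ) ^ (((k : ℝ) + 1) / k * n) ≤ (Real.exp 2) ^ (((k : ℝ) + 1) / k * n) := by gcongr
    _ = Real.exp (2 * (((k : ℝ) + 1) / k * n)) := by rw [← Real.exp_mul]
    _ ≤ Real.exp (4 * n) := by
        have := mul_le_mul_of_nonneg_right h2 (n.cast_nonneg (α := ℝ))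
        rw [Real.exp_le_exp]
        linarith

/-- **Theorem 6.1.** Let `r ≥ 2` and let `Q` be an ordered `r`-matching with
at least two edges. Suppose `ex_<(n', Q) ≤ α·(n')^(r-1)` for all `n' ≥ n_Q`.
Then, for all `n` sufficiently large in terms of `r` and `n_Q`, the number of
`Q`-free ordered `r`-matchings of size `n` is at most
`e^(40n)·(α·r^r·n^(r-2))^((r/(r-1))·n)`. -/
theorem count_Q_free_matchings (r nQ : ℕ) (hr : 2 ≤ r) (hnQ : 0 < nQ) :
    ∃ N : ℕ, ∀ (q : ℕ) (Q : Finset (Finset ℕ)) (α : ℝ),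
      2 ≤ q → IsOrderedMatching r q Q → 0 < α →
      (∀ n' : ℕ, nQ ≤ n' → (exOrd r n' Q : ℝ) ≤ α * (n' : ℝ) ^ (r - 1)) →
      ∀ n : ℕ, N ≤ n →
        (qFreeMatchingCount r n Q : ℝ) ≤
          Real.exp (40 * n) *
            (α * (r : ℝ) ^ r * (n : ℝ) ^ (r - 2)) ^ (((r : ℝ) / ((r : ℝ) - 1)) * (n : ℝ)) := by
  obtain ⟨k, rfl⟩ : ∃ k, r = k + 1 := ⟨r - 1, by omega⟩
  have hk : 0 < k := by omega
  refine ⟨(2 * (nQ + 4 * (k + 1) ^ 2)) ^ (k + 1), fun q Q α hq hQ hα hex n hn => ?_⟩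
  have hn0 : 0 < n := lt_of_lt_of_le (by positivity) hn
  simp only [Nat.add_sub_cancel, Nat.cast_add, Nat.cast_one, add_sub_cancel_right,
    show k + 1 - 2 = k - 1 by omega] at hex ⊢
  set X : ℝ := α * ((k : ℝ) + 1) ^ (k + 1) * (n : ℝ) ^ (k - 1) with hX
  have hX0 : 0 < X := by positivity
  have hyk : ((3 * X) ^ ((k : ℝ)⁻¹)) ^ k = 3 * X :=
    Real.rpow_inv_natCast_pow (by positivity) hk.ne'
  refine (qFreeMatchingCount_le_of_pow_le hk hq hQ hα hex le_rfl hn (by positivity) hyk).trans ?_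
  calc _ ≤ Real.exp (12 * n) * (Real.exp (4 * n) * X ^ (((k : ℝ) + 1) / k * n)) := by
        gcongr
        exact rpow_root_pow_le hk n hX0
    _ = Real.exp (16 * n) * X ^ (((k : ℝ) + 1) / k * n) := by
        rw [← mul_assoc, ← Real.exp_add]
        ring_nf
    _ ≤ _ := by
        gcongr
        norm_num
end

section
/- Let r ≥ 2 and m ≥ 2 be integers such that r−1 divides m−1, and let b be an integer with b ≥ r(m−1)/(r−1). Set n = C(b+r−(m−1)/(r−1), r) − C(b+r−r(m−1)/(r−1), r), where C(a,b) denotes the binomial coefficient. Then the number of (r−1)-tuples (σ_1,…,σ_{r−1}) of permutations of {1,…,n} having no common increasing subsequence of length m — that is, no indices i_1 < i_2 < … < i_m with σ_j(i_1) < σ_j(i_2) < … < σ_j(i_m) for every j ∈ {1,…,r−1} — is at least e^{−rn}·(r!)^{−(r/(r−1))n}·(m−1)^{(r/(r−1))n}·n^{(r−1−1/(r−1))n}. -/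
/-- The permutations `σ 0, …, σ (t-1)` of `{1,…,n}` have a common increasing
subsequence of length `m`: there are indices `i₁ < … < i_m` with
`σ j (i₁) < … < σ j (i_m)` for every `j`. -/
def HasCommonIncSubseq {t n : ℕ} (m : ℕ) (σ : Fin t → Equiv.Perm (Fin n)) : Prop :=
  ∃ f : Fin m → Fin n, StrictMono f ∧ ∀ j : Fin t, StrictMono fun k => σ j (f k)

theorem mul_pow_le_ascFactorial_sub (a M d : ℕ) :
    M * (a + M + 1) ^ d + (a + 1).ascFactorial (d + 1) ≤ (a + M + 1).ascFactorial (d + 1) := by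
  have hpow : (a + M + 1) ^ d ≤ (a + M + 1).ascFactorial d := Nat.pow_succ_le_ascFactorial _ _
  have hmono : (a + 1).ascFactorial d ≤ (a + M + 1).ascFactorial d :=
    Nat.ascFactorial_le d (by omega)
  rw [Nat.ascFactorial_succ, Nat.ascFactorial_succ]
  nlinarith [Nat.mul_le_mul_left M hpow, Nat.mul_le_mul_left (a + 1 + d) hmono]

theorem mul_pow_le_factorial_mul_choose_sub (a M d : ℕ) :
    M * (a + M + 1) ^ d ≤
      (d + 1).factorial * ((a + M + (d + 1)).choose (d + 1) - (a + (d + 1)).choose (d + 1)) := by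
  have h := mul_pow_le_ascFactorial_sub a M d
  rw [Nat.ascFactorial_eq_factorial_mul_choose, Nat.ascFactorial_eq_factorial_mul_choose] at h
  rw [Nat.mul_sub]
  omega

/-- The points of `ℕ ^ (d + 1)` whose coordinate sum lies in `(a, N]`. -/
def simplexSlab (d a N : ℕ) : Finset (Fin (d + 1) →₀ ℕ) :=
  (Finset.Ioc a N).biUnion fun s => Finset.finsuppAntidiag Finset.univ s

theorem mem_simplexSlab {d a N : ℕ} {p : Fin (d + 1) →₀ ℕ} :
    p ∈ simplexSlab d a N ↔ a < ∑ i, p i ∧ ∑ i, p i ≤ N := by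
  simp [simplexSlab, Finset.mem_finsuppAntidiag]

theorem card_simplexSlab {d a N : ℕ} (h : a ≤ N) :
    (simplexSlab d a N).card = (N + (d + 1)).choose (d + 1) - (a + (d + 1)).choose (d + 1) := by
  have hlayer (s : ℕ) : (Finset.finsuppAntidiag (Finset.univ : Finset (Fin (d + 1))) s).card =
      (s + d).choose d := by
    rw [Finset.card_finsuppAntidiag_nat_eq_choose]
    simp only [Finset.card_univ, Fintype.card_fin]
    rw [show d + 1 + s - 1 = s + d by omega, Nat.choose_symm_add]
  rw [simplexSlab, Finset.card_biUnion]
  · simp only [hlayer]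
    have hsplit : ∑ s ∈ Finset.range (a + 1), (s + d).choose d +
        ∑ s ∈ Finset.Ioc a N, (s + d).choose d =
        ∑ s ∈ Finset.range (N + 1), (s + d).choose d := by
      rw [← Finset.sum_range_add_sum_Ico _ (show a + 1 ≤ N + 1 by omega)]
      congr 2
      ext s
      simp only [Finset.mem_Ioc, Finset.mem_Ico]
      omega
    rw [Nat.sum_range_add_choose, Nat.sum_range_add_choose] at hsplit
    rw [← add_assoc, ← add_assoc]
    omega
  · intro s _ t _ hst
    rw [Function.onFun, Finset.disjoint_left]
    intro p hs ht
    rw [Finset.mem_finsuppAntidiag] at hs ht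
    exact hst (hs.1.symm.trans ht.1)

theorem pow_mul_exp_neg_le_factorial {c : ℝ} (hc : 0 ≤ c) (N : ℕ) :
    c ^ N * Real.exp (-c) ≤ (N.factorial : ℝ) := by
  have h := Real.pow_div_factorial_le_exp c hc N
  rw [div_le_iff₀ (by positivity)] at h
  rw [Real.exp_neg, ← div_eq_mul_inv, div_le_iff₀ (Real.exp_pos c)]
  linarith

/-- A function taking at most `T` values is preserved by at least `(|S| / (e T)) ^ |S|`
permutations. -/
theorem pow_mul_exp_neg_le_card_perm_preserving {S : Type*} [Fintype S] [DecidableEq S]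
    (f : S → ℕ) {T : ℕ} (hT : 0 < T) (hf : ∀ s, f s < T) :
    ((Fintype.card S : ℝ) / T) ^ Fintype.card S * Real.exp (-(Fintype.card S : ℝ)) ≤
      (Nat.card {g : Equiv.Perm S // f ∘ g = f} : ℝ) := by
  set c : ℝ := (Fintype.card S : ℝ) / T with hc
  have hc0 : 0 ≤ c := by positivity
  have hcT : c * T = Fintype.card S := by
    rw [hc]; field_simp
  have himage : (Finset.univ.image f).card ≤ T := by
    rw [← Finset.card_range T]
    refine Finset.card_le_card fun t ht => ?_
    obtain ⟨s, -, rfl⟩ := Finset.mem_image.1 ht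
    exact Finset.mem_range.2 (hf s)
  have hsum : ∑ t ∈ Finset.univ.image f, Fintype.card {s // f s = t} = Fintype.card S := by
    rw [← Finset.card_univ, Finset.card_eq_sum_card_image f]
    exact Finset.sum_congr rfl fun t _ => Fintype.card_subtype _
  rw [Nat.card_eq_fintype_card, DomMulAct.stabilizer_card']
  push_cast
  calc c ^ Fintype.card S * Real.exp (-(Fintype.card S : ℝ))
      ≤ c ^ Fintype.card S * Real.exp (-c * (Finset.univ.image f).card) := by
        have : ((Finset.univ.image f).card : ℝ) ≤ T := by exact_mod_cast himage
        gcongr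
        nlinarith
    _ = ∏ t ∈ Finset.univ.image f, c ^ Fintype.card {s // f s = t} * Real.exp (-c) := by
        rw [Finset.prod_mul_distrib, Finset.prod_pow_eq_pow_sum, hsum, Finset.prod_const,
          ← Real.exp_nat_mul, mul_comm (-c)]
    _ ≤ _ := Finset.prod_le_prod (fun _ _ => by positivity)
        fun t _ => pow_mul_exp_neg_le_factorial hc0 _

theorem exists_equiv_fin_monotone {S : Type*} [Fintype S] {n : ℕ} (hS : Fintype.card S = n)
    (f : S → ℕ) : ∃ e : S ≃ Fin n, Monotone (f ∘ e.symm) := by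
  obtain ⟨e⟩ : Nonempty (S ≃ Fin n) := ⟨Fintype.equivFinOfCardEq hS⟩
  exact ⟨e.trans (Tuple.sort (f ∘ e.symm)).symm, Tuple.monotone_sort (f ∘ e.symm)⟩

/-- If the points of `S` are separated by their `d + 1` coordinates and their coordinate sums take
fewer than `m` consecutive values, then independently breaking the ties of each coordinate order
yields distinct tuples of permutations without common increasing subsequence of length `m`. -/
theorem prod_card_perm_preserving_le {S : Type*} [Fintype S] {n d m a : ℕ}
    (hm : 0 < m) (hS : Fintype.card S = n) (x : S → Fin (d + 1) → ℕ) (hx : Function.Injective x)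
    (hlow : ∀ s, a < ∑ i, x s i) (hhigh : ∀ s, ∑ i, x s i < a + m) :
    ∏ i, Nat.card {g : Equiv.Perm S // (fun s => x s i) ∘ g = fun s => x s i} ≤
      Nat.card {σ : Fin d → Equiv.Perm (Fin n) // ¬ HasCommonIncSubseq m σ} := by
  choose e he using fun i => exists_equiv_fin_monotone hS fun s => x s i
  rw [← Nat.card_pi]
  let L (g : ∀ i, {g : Equiv.Perm S // (fun s => x s i) ∘ g = fun s => x s i}) (i : Fin (d + 1)) :
      S ≃ Fin n := (g i).1.trans (e i)
  have hL (g i s) : x ((e i).symm (L g i s)) i = x s i := by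
    simpa [L] using congrFun (g i).2 s
  refine Nat.card_le_card_of_injective
    (fun g => ⟨fun j => (L g 0).symm.trans (L g j.succ), ?_⟩) ?_
  · rintro ⟨f, hf, hσ⟩
    let y (k : Fin m) : S := (L g 0).symm (f k)
    have hy : ∀ i, StrictMono fun k => L g i (y k) := by
      refine Fin.cases ?_ fun j => ?_
      · simpa [y] using hf
      · simpa [y] using hσ j
    have hcoord (i) : Monotone fun k => x (y k) i := fun k l hkl => by
      simpa [hL] using he i ((hy i).monotone hkl)
    have hsum : StrictMono fun k => ∑ i, x (y k) i := fun k l hkl => by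
      refine Fintype.sum_strictMono (lt_of_le_of_ne (fun i => hcoord i hkl.le) fun h => ?_)
      have := hy 0 hkl
      simp [hx h] at this
    have hcard := Finset.card_le_card_of_injOn (s := Finset.univ) (t := Finset.Ioo a (a + m))
      (fun k => ∑ i, x (y k) i) (fun k _ => by simpa using ⟨hlow (y k), hhigh (y k)⟩)
      hsum.injective.injOn
    simp only [Finset.card_univ, Fintype.card_fin, Nat.card_Ioo] at hcard
    omega
  · intro g g' hgg
    have hcomp (j : Fin d) (s) : L g j.succ ((L g 0).symm s) = L g' j.succ ((L g' 0).symm s) :=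
      congrArg (fun σ => σ.1 j s) hgg
    have hLL (i s) : L g' i ((L g' 0).symm (L g 0 s)) = L g i s := by
      induction i using Fin.cases with
      | zero => simp
      | succ j => simp [← hcomp]
    have hπ (s) : (L g' 0).symm (L g 0 s) = s := hx <| funext fun i => by
      rw [← hL g' i, hLL, hL]
    ext i s
    have := hLL i s
    rw [hπ] at this
    exact ((e i).injective this).symm ▸ rfl

theorem exp_mul_rpow_le_pow {d M n T : ℕ} (hd : 0 < d) (hM : 0 < M) (hT : 0 < T)
    (h : M * T ^ d ≤ (d + 1).factorial * n) :
    Real.exp (-(((d : ℝ) + 1) * n)) *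
        ((d + 1).factorial : ℝ) ^ (-((((d : ℝ) + 1) / d) * (n : ℝ))) *
        (M : ℝ) ^ ((((d : ℝ) + 1) / d) * (n : ℝ)) *
        (n : ℝ) ^ (((d : ℝ) - 1 / d) * (n : ℝ)) ≤
      (((n : ℝ) / T) ^ n * Real.exp (-(n : ℝ))) ^ (d + 1) := by
  have hn : 0 < n := by
    rcases Nat.eq_zero_or_pos n with rfl | h0
    · have : 0 < M * T ^ d := by positivity
      omega
    · exact h0
  have hd' : (0 : ℝ) < d := by exact_mod_cast hd
  have hn' : (0 : ℝ) < n := by exact_mod_cast hn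
  have hT' : (0 : ℝ) < T := by exact_mod_cast hT
  have hF : (0 : ℝ) < (d + 1).factorial := by positivity
  set p : ℝ := ((d : ℝ) + 1) / d * n with hp
  have hp0 : 0 ≤ p := by positivity
  have hbase : (M : ℝ) / (d + 1).factorial ≤ n / (T : ℝ) ^ d := by
    rw [div_le_div_iff₀ hF (by positivity), mul_comm (n : ℝ)]
    exact_mod_cast h
  have hpow : (M : ℝ) ^ p / ((d + 1).factorial : ℝ) ^ p ≤ n ^ p / (T : ℝ) ^ ((d + 1) * n) := by
    have hTp : ((T : ℝ) ^ d) ^ p = (T : ℝ) ^ ((d + 1) * n) := by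
      rw [← Real.rpow_natCast, ← Real.rpow_mul hT'.le, ← Real.rpow_natCast]
      congr 1
      rw [hp]; push_cast; field_simp
    rw [← hTp, ← Real.div_rpow (by positivity) hF.le, ← Real.div_rpow hn'.le (by positivity)]
    exact Real.rpow_le_rpow (by positivity) hbase hp0
  have hnp : (n : ℝ) ^ p * n ^ (((d : ℝ) - 1 / d) * n) = (n : ℝ) ^ ((d + 1) * n) := by
    rw [← Real.rpow_add hn', ← Real.rpow_natCast]
    congr 1
    rw [hp]; push_cast; field_simp; ring
  have hexp : Real.exp (-(((d : ℝ) + 1) * n)) = Real.exp (-(n : ℝ)) ^ (d + 1) := by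
    rw [← Real.exp_nat_mul]; congr 1; push_cast; ring
  calc _ = Real.exp (-(n : ℝ)) ^ (d + 1) * ((M : ℝ) ^ p / ((d + 1).factorial : ℝ) ^ p) *
        (n : ℝ) ^ (((d : ℝ) - 1 / d) * n) := by
        rw [hexp, Real.rpow_neg hF.le, div_eq_mul_inv]; ring
    _ ≤ Real.exp (-(n : ℝ)) ^ (d + 1) * (n ^ p / (T : ℝ) ^ ((d + 1) * n)) *
        (n : ℝ) ^ (((d : ℝ) - 1 / d) * n) := by gcongr
    _ = Real.exp (-(n : ℝ)) ^ (d + 1) *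
        (n ^ p * (n : ℝ) ^ (((d : ℝ) - 1 / d) * n) / (T : ℝ) ^ ((d + 1) * n)) := by ring
    _ = _ := by
        rw [hnp, mul_pow, ← pow_mul, mul_comm n, div_pow, mul_comm]

/-- **Theorem 6.5.** Let `r, m ≥ 2` with `r-1 ∣ m-1`, let
`b ≥ r(m-1)/(r-1)`, and set
`n = C(b+r-(m-1)/(r-1), r) - C(b+r-r(m-1)/(r-1), r)`. Then the number of
`(r-1)`-tuples of permutations of `{1,…,n}` with no common increasing
subsequence of length `m` is at least
`e^(-rn)·(r!)^(-(r/(r-1))n)·(m-1)^((r/(r-1))n)·n^((r-1-1/(r-1))n)`. -/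
theorem count_tuples_no_common_increasing (r m b n : ℕ) (hr : 2 ≤ r) (hm : 2 ≤ m)
    (hdvd : (r - 1) ∣ (m - 1)) (hb : r * ((m - 1) / (r - 1)) ≤ b)
    (hn : n = (b + r - (m - 1) / (r - 1)).choose r
        - (b + r - r * ((m - 1) / (r - 1))).choose r) :
    Real.exp (-((r : ℝ) * n)) *
        (r.factorial : ℝ) ^ (-(((r : ℝ) / ((r : ℝ) - 1)) * (n : ℝ))) *
        ((m : ℝ) - 1) ^ (((r : ℝ) / ((r : ℝ) - 1)) * (n : ℝ)) *
        (n : ℝ) ^ ((((r : ℝ) - 1) - 1 / ((r : ℝ) - 1)) * (n : ℝ))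
      ≤ (Nat.card {σ : Fin (r - 1) → Equiv.Perm (Fin n) //
          ¬ HasCommonIncSubseq m σ} : ℝ) := by
  obtain ⟨d, rfl⟩ : ∃ d, r = d + 1 := ⟨r - 1, by omega⟩
  obtain ⟨M, rfl⟩ : ∃ M, m = M + 1 := ⟨m - 1, by omega⟩
  simp only [Nat.add_sub_cancel] at hdvd hb hn ⊢
  have hd : 0 < d := by omega
  obtain ⟨k, rfl⟩ := hdvd
  rw [Nat.mul_div_cancel_left k hd] at hb hn
  obtain ⟨a, rfl⟩ := Nat.exists_eq_add_of_le hb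
  rw [show (d + 1) * k + a + (d + 1) - k = a + d * k + (d + 1) by
      rw [add_mul]; omega,
    show (d + 1) * k + a + (d + 1) - (d + 1) * k = a + (d + 1) by omega] at hn
  have hS : Fintype.card (simplexSlab d a (a + d * k)) = n := by
    rw [Fintype.card_coe, card_simplexSlab (by omega), hn]
  have hbound := mul_pow_le_factorial_mul_choose_sub a (d * k) d
  rw [← hn] at hbound
  have hcount := prod_card_perm_preserving_le (m := d * k + 1) (a := a) (by omega) hS
    (fun p i => p.1 i) (fun p q h => Subtype.ext (DFunLike.coe_injective h))
    (fun p => (mem_simplexSlab.1 p.2).1)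
    (fun p => by have := (mem_simplexSlab.1 p.2).2; omega)
  have hcoord (i : Fin (d + 1)) := pow_mul_exp_neg_le_card_perm_preserving
    (fun p : simplexSlab d a (a + d * k) => p.1 i) (T := a + d * k + 1) (by omega) fun p => by
      have := Finset.single_le_sum (f := p.1) (fun _ _ => Nat.zero_le _) (Finset.mem_univ i)
      have := (mem_simplexSlab.1 p.2).2
      omega
  have hprod := Finset.prod_le_prod (s := Finset.univ) (fun _ _ => by positivity)
    fun i _ => hcoord i
  rw [hS, Finset.prod_const, Finset.card_univ, Fintype.card_fin] at hprod
  have hreal := exp_mul_rpow_le_pow hd (show 0 < d * k by omega) (Nat.succ_pos _) hbound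
  have hcast : ((d + 1 : ℕ) : ℝ) - 1 = d := by push_cast; ring
  have hcast' : ((d * k + 1 : ℕ) : ℝ) - 1 = (d * k : ℕ) := by push_cast; ring
  rw [hcast, hcast']
  simp only [Nat.cast_add_one (R := ℝ) d]
  exact hreal.trans (hprod.trans (by exact_mod_cast hcount))
end
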